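/- arXiv:1001.4773 — 6 statements merged into one kernel-verified Lean document; each statement's English description precedes it below -/
import Mathlib

section
/- Let Γ be a non-abelian group of orientation-preserving homeomorphisms of the real line ℝ such that every element of Γ other than the identity has at most one fixed point. Then Γ is isomorphic to a subgroup of the orientation-preserving affine group of ℝ; that is, there exists an injective group homomorphism ρ from Γ into the group of maps x ↦ a·x + b with a > 0, b ∈ ℝ. -/
open Filter Topology

/-- In a bi-ordered group, powers of `g * h` lie between the products of powers of `g` and `h`
taken in the two possible orders. -/
theorem pow_mul_pow_le_mul_pow_le {G : Type*} [Group G] [LinearOrder G] [MulLeftMono G]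
    [MulRightMono G] {g h : G} (hgh : g * h ≤ h * g) (n : ℕ) :
    g ^ n * h ^ n ≤ (g * h) ^ n ∧ (g * h) ^ n ≤ h ^ n * g ^ n := by
  have key₁ : ∀ n : ℕ, g ^ n * h ≤ h * g ^ n := by
    intro n
    induction n with
    | zero => simp
    | succ k ih =>
      calc g ^ (k + 1) * h = g ^ k * (g * h) := by rw [pow_succ, mul_assoc]
        _ ≤ g ^ k * (h * g) := by gcongr
        _ = (g ^ k * h) * g := by rw [mul_assoc]
        _ ≤ (h * g ^ k) * g := by gcongr
        _ = h * g ^ (k + 1) := by rw [pow_succ, mul_assoc]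
  have key₂ : ∀ n : ℕ, g * h ^ n ≤ h ^ n * g := by
    intro n
    induction n with
    | zero => simp
    | succ k ih =>
      calc g * h ^ (k + 1) = (g * h) * h ^ k := by rw [pow_succ', mul_assoc]
        _ ≤ (h * g) * h ^ k := by gcongr
        _ = h * (g * h ^ k) := by rw [mul_assoc]
        _ ≤ h * (h ^ k * g) := by gcongr
        _ = h ^ (k + 1) * g := by rw [pow_succ', mul_assoc]
  induction n with
  | zero => simp
  | succ k ih =>
    constructor
    · calc g ^ (k + 1) * h ^ (k + 1) = g * (g ^ k * h) * h ^ k := by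
            rw [pow_succ' g, pow_succ' h]; simp only [mul_assoc]
        _ ≤ g * (h * g ^ k) * h ^ k := mul_le_mul_left (mul_le_mul_right (key₁ k) g) _
        _ = (g * h) * (g ^ k * h ^ k) := by simp only [mul_assoc]
        _ ≤ (g * h) * (g * h) ^ k := by gcongr; exact ih.1
        _ = (g * h) ^ (k + 1) := by rw [pow_succ']
    · calc (g * h) ^ (k + 1) = (g * h) * (g * h) ^ k := by rw [pow_succ']
        _ ≤ (h * g) * (h ^ k * g ^ k) := by gcongr; exact ih.2
        _ = h * (g * h ^ k) * g ^ k := by simp only [mul_assoc]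
        _ ≤ h * (h ^ k * g) * g ^ k := mul_le_mul_left (mul_le_mul_right (key₂ k) h) _
        _ = h ^ (k + 1) * g ^ (k + 1) := by
            rw [pow_succ' h, pow_succ' g]; simp only [mul_assoc]

theorem zpow_lt_zpow_of_one_lt {G : Type*} [Group G] [LinearOrder G] [MulLeftMono G]
    {u : G} (hu : 1 < u) {m n : ℤ} (h : m < n) : u ^ m < u ^ n := by
  have : u ^ n = u ^ m * u ^ (n - m) := by rw [← zpow_add]; congr 1; ring
  rw [this]
  exact lt_mul_of_one_lt_right' _ (one_lt_zpow hu (by omega))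

/-- Integer part of the elements of a bi-ordered group relative to a cofinal element. -/
theorem exists_zpow_ceil {G : Type*} [Group G] [LinearOrder G] [MulLeftMono G] [MulRightMono G]
    {u : G} (hu : 1 < u) (hcof : ∀ g : G, ∃ n : ℕ, g ≤ u ^ n) (g : G) :
    ∃ c : ℤ, g ≤ u ^ c ∧ u ^ (c - 1) < g := by
  obtain ⟨m, hm⟩ := hcof g
  obtain ⟨k, hk⟩ := hcof g⁻¹
  obtain ⟨c, hc, hleast⟩ := Int.exists_least_of_bdd (P := fun z : ℤ => g ≤ u ^ z)
    ⟨-k, fun z hz => by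
      by_contra! hlt
      have h₁ := zpow_lt_zpow_of_one_lt hu hlt
      have h₂ : u ^ (-(k : ℤ)) ≤ g := by
        rw [zpow_neg, zpow_natCast]
        exact inv_le_of_inv_le' hk
      exact absurd (hz.trans_lt h₁) (not_lt.mpr h₂)⟩
    ⟨m, by simpa using hm⟩
  refine ⟨c, hc, ?_⟩
  by_contra! hle
  have := hleast _ hle
  omega

/-- **Hölder's construction**: a bi-ordered group with a cofinal positive element `u` has a
monotone homomorphism to `ℝ` mapping `u` to `1`. -/
theorem exists_monotone_hom_of_cofinal {G : Type*} [Group G] [LinearOrder G] [MulLeftMono G]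
    [MulRightMono G] {u : G} (hu : 1 < u) (hcof : ∀ g : G, ∃ n : ℕ, g ≤ u ^ n) :
    ∃ φ : G → ℝ, (∀ g h, φ (g * h) = φ g + φ h) ∧ φ u = 1 ∧ ∀ g, 1 ≤ g → 0 ≤ φ g := by
  choose c hc₁ hc₂ using exists_zpow_ceil hu hcof
  have lt_iff : ∀ {m n : ℤ}, u ^ m < u ^ n → m < n := by
    intro m n h
    by_contra! hle
    rcases hle.eq_or_lt with rfl | hlt
    · exact lt_irrefl _ h
    · exact lt_asymm h (zpow_lt_zpow_of_one_lt hu hlt)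
  have c_mono : ∀ {g h}, g ≤ h → c g ≤ c h := by
    intro g h hgh
    have := lt_iff ((hc₂ g).trans_le (hgh.trans (hc₁ h)))
    omega
  have c_mul_le : ∀ g h, c (g * h) ≤ c g + c h := by
    intro g h
    have h₁ : g * h ≤ u ^ (c g + c h) := by
      rw [zpow_add]; exact mul_le_mul' (hc₁ g) (hc₁ h)
    have := lt_iff ((hc₂ (g * h)).trans_le h₁)
    omega
  have le_c_mul : ∀ g h, c g + c h - 1 ≤ c (g * h) := by
    intro g h
    have h₁ : u ^ ((c g - 1) + (c h - 1)) < g * h := by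
      rw [zpow_add]; exact mul_lt_mul_of_lt_of_le (hc₂ g) (hc₂ h).le
    have := lt_iff (h₁.trans_le (hc₁ (g * h)))
    omega
  have c_zpow : ∀ n : ℤ, c (u ^ n) = n := by
    intro n
    have h₁ := lt_iff (hc₂ (u ^ n))
    have h₂ : n ≤ c (u ^ n) := by
      by_contra! hlt
      exact absurd (zpow_lt_zpow_of_one_lt hu hlt) (not_lt.mpr (hc₁ (u ^ n)))
    omega
  have hsub : ∀ g, Subadditive fun n : ℕ => (c (g ^ n) : ℝ) := by
    intro g m n
    have := c_mul_le (g ^ m) (g ^ n)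
    simp only [pow_add]
    exact_mod_cast this
  have hlow : ∀ g (n : ℕ), (n : ℤ) * (c g - 1) ≤ c (g ^ n) := by
    intro g n
    have := c_mono (pow_le_pow_left' (hc₂ g).le n)
    rwa [← zpow_natCast, ← zpow_mul, c_zpow, mul_comm] at this
  have hbdd : ∀ g, BddBelow (Set.range fun n : ℕ => (c (g ^ n) : ℝ) / n) := by
    intro g
    refine ⟨min 0 ((c g : ℝ) - 1), ?_⟩
    rintro _ ⟨n, rfl⟩
    rcases Nat.eq_zero_or_pos n with rfl | hn
    · simp
    · have hn' : (0 : ℝ) < n := by exact_mod_cast hn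
      refine (min_le_right _ _).trans ?_
      rw [le_div_iff₀ hn', mul_comm]
      exact_mod_cast hlow g n
  have hlim : ∀ g, Tendsto (fun n : ℕ => (c (g ^ n) : ℝ) / n) atTop (𝓝 (hsub g).lim) :=
    fun g => (hsub g).tendsto_lim (hbdd g)
  refine ⟨fun g => (hsub g).lim, ?_, ?_, ?_⟩
  · intro g h
    have hclose : ∀ n : ℕ, c (g ^ n) + c (h ^ n) - 1 ≤ c ((g * h) ^ n) ∧
        c ((g * h) ^ n) ≤ c (g ^ n) + c (h ^ n) := by
      intro n
      rcases le_total (g * h) (h * g) with hle | hle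
      · obtain ⟨h₁, h₂⟩ := pow_mul_pow_le_mul_pow_le hle n
        have := c_mono h₁
        have := c_mono h₂
        have := le_c_mul (g ^ n) (h ^ n)
        have := c_mul_le (h ^ n) (g ^ n)
        omega
      · obtain ⟨h₁, h₂⟩ : h ^ n * g ^ n ≤ (g * h) ^ n ∧ (g * h) ^ n ≤ g ^ n * h ^ n :=
          (pow_mul_pow_le_mul_pow_le (G := Gᵒᵈ) (g := OrderDual.toDual g)
            (h := OrderDual.toDual h) hle n).symm
        have := c_mono h₁
        have := c_mono h₂
        have := le_c_mul (h ^ n) (g ^ n)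
        have := c_mul_le (g ^ n) (h ^ n)
        omega
    have hinv : Tendsto (fun n : ℕ => ((1 : ℝ) / n)) atTop (𝓝 0) :=
      tendsto_one_div_atTop_nhds_zero_nat
    have hsum := (hlim g).add (hlim h)
    refine le_antisymm (le_of_tendsto_of_tendsto' (hlim (g * h)) hsum fun n => ?_) ?_
    · rw [← add_div]
      gcongr
      exact_mod_cast (hclose n).2
    · have := hsum.sub hinv
      rw [sub_zero] at this
      refine le_of_tendsto_of_tendsto' this (hlim (g * h)) fun n => ?_
      rw [← add_div, ← sub_div]
      gcongr
      exact_mod_cast (hclose n).1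
  · refine tendsto_nhds_unique (hlim u) (tendsto_const_nhds.congr' ?_)
    filter_upwards [eventually_gt_atTop 0] with n hn
    have hn' : (n : ℝ) ≠ 0 := by exact_mod_cast hn.ne'
    rw [← zpow_natCast, c_zpow]
    simp [hn']
  · intro g hg
    refine ge_of_tendsto' (hlim g) fun n => ?_
    have h₁ : c 1 ≤ c (g ^ n) := c_mono (one_le_pow_of_one_le' hg n)
    have h₂ : c 1 = 0 := by simpa using c_zpow 0
    have : (0 : ℝ) ≤ c (g ^ n) := by exact_mod_cast h₂ ▸ h₁
    positivity

section RealHom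

variable {G : Type*} [Group G] {φ : G → ℝ}

theorem real_hom_zpow (hφ : ∀ g h, φ (g * h) = φ g + φ h) (g : G) (n : ℤ) :
    φ (g ^ n) = n * φ g := by
  let Φ : G →* Multiplicative ℝ := MonoidHom.mk' (fun g => Multiplicative.ofAdd (φ g)) fun g h => by
    rw [hφ, ofAdd_add]
  have := congrArg Multiplicative.toAdd (map_zpow Φ g n)
  rw [toAdd_zpow, zsmul_eq_mul] at this
  exact this

theorem real_hom_pow (hφ : ∀ g h, φ (g * h) = φ g + φ h) (g : G) (n : ℕ) :
    φ (g ^ n) = n * φ g := by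
  simpa using real_hom_zpow hφ g n

theorem real_hom_inv (hφ : ∀ g h, φ (g * h) = φ g + φ h) (g : G) : φ g⁻¹ = -φ g := by
  simpa using real_hom_zpow hφ g (-1)

theorem real_hom_one (hφ : ∀ g h, φ (g * h) = φ g + φ h) : φ 1 = 0 := by
  simpa using real_hom_zpow hφ 1 0

theorem real_hom_commutator (hφ : ∀ g h, φ (g * h) = φ g + φ h) (g h : G) :
    φ (g * h * g⁻¹ * h⁻¹) = 0 := by
  simp only [hφ, real_hom_inv hφ]; ring

/-- A real homomorphism `σ` that is nonnegative wherever the real homomorphism `τ` is positive is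
a multiple of `τ`. -/
theorem real_hom_proportional {τ σ : G → ℝ} (hτ : ∀ g h, τ (g * h) = τ g + τ h)
    (hσ : ∀ g h, σ (g * h) = σ g + σ h) (hle : ∀ g, 0 < τ g → 0 ≤ σ g) {t : G} (ht : τ t = 1)
    (g : G) : σ g = σ t * τ g := by
  have ht0 : 0 ≤ σ t := hle t (by rw [ht]; exact one_pos)
  have upper : ∀ g, σ g ≤ σ t * τ g := by
    intro g
    have hrat : ∀ r : ℚ, τ g < r → σ g ≤ σ t * r := by
      intro r hr
      have hden : (0 : ℝ) < r.den := by exact_mod_cast r.den_pos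
      have hr' : (r : ℝ) = r.num / r.den := by exact_mod_cast (Rat.num_div_den r).symm
      have h₁ : 0 < τ (t ^ r.num * (g ^ r.den)⁻¹) := by
        rw [hτ, real_hom_inv hτ, real_hom_pow hτ, real_hom_zpow hτ, ht]
        rw [hr', lt_div_iff₀ hden] at hr
        linarith
      have h₂ := hle _ h₁
      rw [hσ, real_hom_inv hσ, real_hom_pow hσ, real_hom_zpow hσ] at h₂
      rw [hr', mul_div_assoc', le_div_iff₀ hden]
      linarith
    rcases ht0.eq_or_lt with h0 | hpos
    · obtain ⟨r, hr⟩ := exists_rat_gt (τ g)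
      simpa [← h0] using hrat r hr
    · by_contra! hlt
      have : τ g < σ g / σ t := by rw [lt_div_iff₀ hpos]; linarith
      obtain ⟨r, hr₁, hr₂⟩ := exists_rat_btwn this
      rw [lt_div_iff₀ hpos] at hr₂
      linarith [hrat r hr₁]
  refine le_antisymm (upper g) ?_
  have := upper g⁻¹
  rw [real_hom_inv hτ, real_hom_inv hσ] at this
  linarith

end RealHom

/-- Every non-identity element of the acting group has at most one fixed point. -/
def AtMostOneFixedPoint {G : Type*} [Group G] (ρ : G →* (ℝ ≃o ℝ)) : Prop :=
  ∀ g : G, g ≠ 1 → ∀ x y : ℝ, ρ g x = x → ρ g y = y → x = y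

/-- `q` is a fixed point of `e` and `e` moves all other points away from `q`. -/
def IsExpandingAt (e : ℝ ≃o ℝ) (q : ℝ) : Prop :=
  e q = q ∧ (∀ x, q < x → x < e x) ∧ ∀ x, x < q → e x < x

/-- Conjugation of homeomorphisms of the line by `x ↦ -x`. -/
def negConj : (ℝ ≃o ℝ) →* (ℝ ≃o ℝ) where
  toFun e :=
    { toEquiv := (Equiv.neg ℝ).trans (e.toEquiv.trans (Equiv.neg ℝ))
      map_rel_iff' := by simp }
  map_one' := by ext x; simp
  map_mul' e f := by ext x; simp

@[simp]
theorem negConj_apply (e : ℝ ≃o ℝ) (x : ℝ) : negConj e x = -e (-x) := rfl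

theorem IsExpandingAt.negConj {e : ℝ ≃o ℝ} {q : ℝ} (h : IsExpandingAt e q) :
    IsExpandingAt (negConj e) (-q) := by
  refine ⟨by simp [h.1], fun x hx => ?_, fun x hx => ?_⟩
  · have := h.2.2 (-x) (by linarith)
    rw [negConj_apply]; linarith
  · have := h.2.1 (-x) (by linarith)
    rw [negConj_apply]; linarith

theorem exists_agree_of_le_of_le (e f : ℝ ≃o ℝ) {x y : ℝ} (hx : e x ≤ f x) (hy : f y ≤ e y) :
    ∃ z ∈ Set.uIcc x y, e z = f z := by
  obtain ⟨z, hz, h⟩ := intermediate_value_uIcc (a := x) (b := y) (f := fun z => f z - e z)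
    (f.continuous.sub e.continuous).continuousOn
    (show (0 : ℝ) ∈ Set.uIcc _ _ from
      Set.mem_uIcc.mpr (Or.inr ⟨by linarith, by linarith⟩))
  exact ⟨z, hz, by simp only at h; linarith⟩

theorem lt_or_gt_of_no_fixedPoint (e : ℝ ≃o ℝ) {s : Set ℝ} (hs : s.OrdConnected)
    (hfree : ∀ x ∈ s, e x ≠ x) : (∀ x ∈ s, x < e x) ∨ ∀ x ∈ s, e x < x := by
  by_contra! hcon
  obtain ⟨⟨x, hx, hx'⟩, y, hy, hy'⟩ := hcon
  obtain ⟨z, hz, h⟩ := exists_agree_of_le_of_le e 1 hx' hy'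
  exact hfree z (hs.uIcc_subset hx hy hz) h

theorem lt_inv_apply {e : ℝ ≃o ℝ} {x : ℝ} (h : e⁻¹ x < x) : x < e x := by
  have := e.strictMono h
  rwa [← RelIso.mul_apply, mul_inv_cancel, RelIso.one_apply] at this

theorem tendsto_pow_apply_atTop (e : ℝ ≃o ℝ) {x : ℝ} (h : ∀ y, x ≤ y → y < e y) :
    Tendsto (fun n : ℕ => (e ^ n) x) atTop atTop := by
  have hge : ∀ n : ℕ, x ≤ (e ^ n) x := by
    intro n
    induction n with
    | zero => simp
    | succ k ih =>
      rw [pow_succ', RelIso.mul_apply]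
      exact ih.trans (h _ ih).le
  have hmono : Monotone fun n : ℕ => (e ^ n) x := by
    refine monotone_nat_of_le_succ fun n => ?_
    rw [pow_succ', RelIso.mul_apply]
    exact (h _ (hge n)).le
  refine (tendsto_atTop_of_monotone hmono).resolve_right ?_
  rintro ⟨l, hl⟩
  have h₁ : Tendsto (fun n : ℕ => (e ^ (n + 1)) x) atTop (𝓝 (e l)) := by
    simp only [pow_succ', RelIso.mul_apply]
    exact (e.continuous.tendsto l).comp hl
  have h₂ := tendsto_nhds_unique h₁ (hl.comp (tendsto_add_atTop_nat 1))
  exact (h l (ge_of_tendsto' hl hge)).ne' h₂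

theorem tendsto_pow_apply_atBot (e : ℝ ≃o ℝ) {x : ℝ} (h : ∀ y, y ≤ x → e y < y) :
    Tendsto (fun n : ℕ => (e ^ n) x) atTop atBot := by
  have := tendsto_pow_apply_atTop (negConj e) (x := -x) fun y hy => by
    have := h (-y) (by linarith)
    rw [negConj_apply]; linarith
  simp only [← map_pow, negConj_apply, neg_neg] at this
  simpa using this

theorem tendsto_pow_apply_atTop_of_forall (e : ℝ ≃o ℝ) (h : ∀ y, y < e y) (x : ℝ) :
    Tendsto (fun n : ℕ => (e ^ n) x) atTop atTop :=
  tendsto_pow_apply_atTop e fun y _ => h y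

namespace AtMostOneFixedPoint

variable {G : Type*} [Group G] {ρ : G →* (ℝ ≃o ℝ)}

theorem negConj (hfix : AtMostOneFixedPoint ρ) : AtMostOneFixedPoint (negConj.comp ρ) := by
  intro g hg x y hx hy
  simp only [MonoidHom.comp_apply, negConj_apply] at hx hy
  have := hfix g hg (-x) (-y) (by linarith) (by linarith)
  linarith

theorem comp_subtype (hfix : AtMostOneFixedPoint ρ) (H : Subgroup G) :
    AtMostOneFixedPoint (ρ.comp H.subtype) := by
  intro g hg x y hx hy
  exact hfix g (by simpa using hg) x y hx hy

theorem eq_of_apply_eq (hfix : AtMostOneFixedPoint ρ) {g h : G} {x y : ℝ} (hxy : x ≠ y)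
    (hx : ρ g x = ρ h x) (hy : ρ g y = ρ h y) : g = h := by
  by_contra hne
  have key : ∀ z, ρ g z = ρ h z → ρ (h⁻¹ * g) z = z := by
    intro z hz
    rw [map_mul, RelIso.mul_apply, hz, ← RelIso.mul_apply, ← map_mul]
    simp
  exact hxy (hfix (h⁻¹ * g) (fun h' => hne (inv_mul_eq_one.mp h').symm) x y (key x hx) (key y hy))

theorem lt_of_crossing (hfix : AtMostOneFixedPoint ρ) {g h : G} {x y z : ℝ} (hxy : x < y)
    (hx : ρ h x ≤ ρ g x) (hy : ρ g y < ρ h y) (hyz : y ≤ z) : ρ g z < ρ h z := by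
  by_contra! hz
  obtain ⟨p, hp, hp'⟩ := exists_agree_of_le_of_le _ _ hx hy.le
  obtain ⟨q, hq, hq'⟩ := exists_agree_of_le_of_le _ _ hz hy.le
  rw [Set.uIcc_of_le hxy.le] at hp
  rw [Set.uIcc_of_ge hyz] at hq
  have hpy : p < y := lt_of_le_of_ne hp.2 (by rintro rfl; exact hy.ne hp'.symm)
  have := hfix.eq_of_apply_eq (hpy.trans_le hq.1).ne hp' hq'
  rw [this] at hy
  exact lt_irrefl _ hy

theorem eventually_le_total (hfix : AtMostOneFixedPoint ρ) (g h : G) :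
    (∀ᶠ x in atTop, ρ g x ≤ ρ h x) ∨ ∀ᶠ x in atTop, ρ h x ≤ ρ g x := by
  by_contra! hcon
  obtain ⟨h₁, h₂⟩ := hcon
  obtain ⟨x, hx⟩ := h₁.exists
  obtain ⟨y, hxy, hy⟩ := frequently_atTop.mp h₂ (x + 1)
  refine h₁ ((eventually_ge_atTop y).mono fun z hz => not_lt.mpr ?_)
  exact (hfix.lt_of_crossing (by linarith) hx.le hy hz).le

/-- The order on the group given by comparing germs at `+∞`. -/
@[reducible]
noncomputable def germOrder (hfix : AtMostOneFixedPoint ρ) : LinearOrder G where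
  le g h := ∀ᶠ x in atTop, ρ g x ≤ ρ h x
  le_refl _ := Eventually.of_forall fun _ => le_rfl
  le_trans _ _ _ h₁ h₂ := by filter_upwards [h₁, h₂] with x hx hx' using hx.trans hx'
  le_antisymm g h h₁ h₂ := by
    obtain ⟨a, ha⟩ := eventually_atTop.mp (h₁.and h₂)
    exact hfix.eq_of_apply_eq (x := a) (y := a + 1) (by linarith)
      (le_antisymm (ha a le_rfl).1 (ha a le_rfl).2)
      (le_antisymm (ha (a + 1) (by linarith)).1 (ha (a + 1) (by linarith)).2)
  le_total := hfix.eventually_le_total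
  toDecidableLE := Classical.decRel _

theorem exists_hom_of_cofinal (hfix : AtMostOneFixedPoint ρ) {u : G} (hu : u ≠ 1)
    (hpos : ∀ᶠ x in atTop, x ≤ ρ u x)
    (hcof : ∀ g : G, ∃ n : ℕ, ∀ᶠ x in atTop, ρ g x ≤ ρ (u ^ n) x) :
    ∃ φ : G → ℝ, (∀ g h, φ (g * h) = φ g + φ h) ∧ φ u = 1 ∧
      ∀ g, (∀ᶠ x in atTop, x ≤ ρ g x) → 0 ≤ φ g := by
  let _ := hfix.germOrder
  have : MulLeftMono G := ⟨fun k g h hgh => by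
    refine Eventually.mono (show ∀ᶠ x in atTop, ρ g x ≤ ρ h x from hgh) fun x hx => ?_
    simpa using hx⟩
  have : MulRightMono G := ⟨fun k g h hgh => by
    refine Eventually.mono ((ρ k).tendsto_atTop.eventually
      (show ∀ᶠ x in atTop, ρ g x ≤ ρ h x from hgh)) fun x hx => ?_
    simpa [Function.swap] using hx⟩
  have one_le : ∀ g : G, (∀ᶠ x in atTop, x ≤ ρ g x) → 1 ≤ g := fun g hg =>
    Eventually.mono hg fun x hx => by simpa using hx
  obtain ⟨φ, h₁, h₂, h₃⟩ :=
    exists_monotone_hom_of_cofinal (lt_of_le_of_ne (one_le u hpos) hu.symm) hcof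
  exact ⟨φ, h₁, h₂, fun g hg => h₃ g (one_le g hg)⟩

/-- If every nontrivial germ at `+∞` is cofinal, the group embeds into `ℝ`. -/
theorem exists_injective_hom_of_archimedean (hfix : AtMostOneFixedPoint ρ)
    (harch : ∀ u : G, u ≠ 1 → (∀ᶠ x in atTop, x ≤ ρ u x) →
      ∀ g : G, ∃ n : ℕ, ∀ᶠ x in atTop, ρ g x ≤ ρ (u ^ n) x) :
    ∃ φ : G → ℝ, (∀ g h, φ (g * h) = φ g + φ h) ∧
      (∀ g, (∀ᶠ x in atTop, x ≤ ρ g x) → 0 ≤ φ g) ∧ ∀ g, φ g = 0 → g = 1 := by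
  have hsign : ∀ g : G, (∀ᶠ x in atTop, x ≤ ρ g x) ∨ ∀ᶠ x in atTop, x ≤ ρ g⁻¹ x := by
    intro g
    refine (hfix.eventually_le_total 1 g).imp (fun h => by simpa using h) fun h => ?_
    refine ((ρ g⁻¹).tendsto_atTop.eventually h).mono fun x hx => ?_
    rwa [← RelIso.mul_apply, ← map_mul, mul_inv_cancel, map_one, RelIso.one_apply,
      RelIso.one_apply] at hx
  by_cases htriv : ∀ u : G, u = 1
  · exact ⟨fun _ => 0, by simp, by simp, fun g _ => htriv g⟩
  push Not at htriv
  obtain ⟨u, hu, hpos⟩ : ∃ u : G, u ≠ 1 ∧ ∀ᶠ x in atTop, x ≤ ρ u x := by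
    obtain ⟨u, hu⟩ := htriv
    rcases hsign u with h | h
    · exact ⟨u, hu, h⟩
    · exact ⟨u⁻¹, inv_ne_one.mpr hu, h⟩
  obtain ⟨φ, hφ, hφu, hφpos⟩ := hfix.exists_hom_of_cofinal hu hpos (harch u hu hpos)
  refine ⟨φ, hφ, hφpos, fun g hg => ?_⟩
  by_contra hne
  have key : ∀ g : G, g ≠ 1 → (∀ᶠ x in atTop, x ≤ ρ g x) → φ g ≠ 0 := by
    intro g hne hgpos h0
    obtain ⟨n, hn⟩ := harch g hne hgpos u
    have := hφpos (g ^ n * u⁻¹) <| ((ρ u⁻¹).tendsto_atTop.eventually hn).mono fun x hx => by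
      rwa [← RelIso.mul_apply, ← map_mul, ← RelIso.mul_apply, ← map_mul, mul_inv_cancel, map_one,
        RelIso.one_apply] at hx
    rw [hφ, real_hom_pow hφ, real_hom_inv hφ, h0, hφu] at this
    linarith
  rcases hsign g with h | h
  · exact key g hne h hg
  · exact key g⁻¹ (inv_ne_one.mpr hne) h (by rw [real_hom_inv hφ, hg, neg_zero])

theorem exists_injective_hom_of_free (hfix : AtMostOneFixedPoint ρ)
    (hfree : ∀ g : G, g ≠ 1 → ∀ x, ρ g x ≠ x) :
    ∃ φ : G → ℝ, (∀ g h, φ (g * h) = φ g + φ h) ∧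
      (∀ g, (∀ᶠ x in atTop, x ≤ ρ g x) → 0 ≤ φ g) ∧ ∀ g, φ g = 0 → g = 1 := by
  refine hfix.exists_injective_hom_of_archimedean fun u hu hpos g => ?_
  have hup : ∀ x, x < ρ u x := by
    refine fun x => ((lt_or_gt_of_no_fixedPoint (ρ u) Set.ordConnected_univ
      fun x _ => hfree u hu x).resolve_right fun h => ?_) x trivial
    obtain ⟨x, hx⟩ := hpos.exists
    exact (h x trivial).not_ge hx
  obtain ⟨n, hn⟩ := ((tendsto_pow_apply_atTop_of_forall _ hup 0).eventually_gt_atTop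
    (ρ g 0)).exists
  rw [← map_pow] at hn
  refine ⟨n, (eventually_ge_atTop 0).mono fun x _ => ?_⟩
  by_contra! hx
  obtain ⟨z, -, hz⟩ := exists_agree_of_le_of_le _ _ hx.le hn.le
  refine hfree (g⁻¹ * u ^ n) (fun h => ?_) z ?_
  · rw [inv_mul_eq_one.mp h] at hx
    exact lt_irrefl _ hx
  · rw [map_mul, RelIso.mul_apply, hz, ← RelIso.mul_apply, ← map_mul]
    simp

theorem exists_injective_hom_of_fixed (hfix : AtMostOneFixedPoint ρ) {q : ℝ}
    (hq : ∀ g : G, ρ g q = q) :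
    ∃ φ : G → ℝ, (∀ g h, φ (g * h) = φ g + φ h) ∧
      (∀ g, (∀ᶠ x in atTop, x ≤ ρ g x) → 0 ≤ φ g) ∧ ∀ g, φ g = 0 → g = 1 := by
  refine hfix.exists_injective_hom_of_archimedean fun u hu hpos g => ?_
  have hup : ∀ x, q < x → x < ρ u x := by
    refine (lt_or_gt_of_no_fixedPoint (ρ u) (Set.ordConnected_Ioi (a := q))
      fun x hx h => (ne_of_gt hx) (hfix u hu x q h (hq u))).resolve_right fun h => ?_
    obtain ⟨x, hx, hx'⟩ := (hpos.and (eventually_gt_atTop q)).exists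
    exact (h x hx').not_ge hx
  obtain ⟨n, hn⟩ := ((tendsto_pow_apply_atTop (ρ u) (x := q + 1)
    fun y hy => hup y (by linarith)).eventually_gt_atTop (ρ g (q + 1))).exists
  rw [← map_pow] at hn
  exact ⟨n, (eventually_ge_atTop (q + 1)).mono fun x hx =>
    (hfix.lt_of_crossing (lt_add_one q) (by rw [hq, hq]) hn hx).le⟩

theorem exists_apply_ne (hfix : AtMostOneFixedPoint ρ) (hna : ∃ g h : G, g * h ≠ h * g) (q : ℝ) :
    ∃ g, ρ g q ≠ q := by
  by_contra! hq
  obtain ⟨φ, hφ, -, hinj⟩ := hfix.exists_injective_hom_of_fixed hq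
  obtain ⟨g, h, hgh⟩ := hna
  have := hinj _ (real_hom_commutator hφ g h)
  exact hgh (by rwa [mul_inv_eq_one, mul_inv_eq_iff_eq_mul] at this)

theorem exists_fixedPoint (hfix : AtMostOneFixedPoint ρ) (hna : ∃ g h : G, g * h ≠ h * g) :
    ∃ g, g ≠ 1 ∧ ∃ q, ρ g q = q := by
  by_contra! hfree
  obtain ⟨φ, hφ, -, hinj⟩ := hfix.exists_injective_hom_of_free hfree
  obtain ⟨g, h, hgh⟩ := hna
  have := hinj _ (real_hom_commutator hφ g h)
  exact hgh (by rwa [mul_inv_eq_one, mul_inv_eq_iff_eq_mul] at this)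

theorem not_parabolic (hfix : AtMostOneFixedPoint ρ) (hna : ∃ g h : G, g * h ≠ h * g) {k : G}
    {q : ℝ} (hq : ρ k q = q) (hright : ∀ x, q < x → x < ρ k x)
    (hleft : ∀ x, x < q → x < ρ k x) : False := by
  have hlt : ∀ x, x ≠ q → x < ρ k x := fun x hx => hx.lt_or_gt.elim (hleft x) (hright x)
  obtain ⟨g, hg⟩ : ∃ g, q < ρ g q := by
    obtain ⟨g, hg⟩ := hfix.exists_apply_ne hna q
    rcases hg.lt_or_gt with h | h
    · exact ⟨g⁻¹, lt_inv_apply (by simpa using h)⟩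
    · exact ⟨g, h⟩
  set q' := ρ g q with hq'
  have hconj : ∀ x, ρ (g * k * g⁻¹) (ρ g x) = ρ g (ρ k x) := by
    intro x
    simp only [← RelIso.mul_apply, ← map_mul]
    simp
  have hsurj : ∀ y, ∃ x, ρ g x = y := (ρ g).surjective
  have hfixed : ρ (g * k * g⁻¹) q' = q' := by rw [hconj, hq]
  have hle : ∀ y, y ≤ ρ (g * k * g⁻¹) y := by
    intro y
    obtain ⟨x, rfl⟩ := hsurj y
    rw [hconj]
    by_cases hx : x = q
    · rw [hx, hq]
    · exact ((ρ g).strictMono (hlt x hx)).le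
  have hup : ∀ y, q' < y → y < ρ (g * k * g⁻¹) y := by
    intro y hy
    obtain ⟨x, rfl⟩ := hsurj y
    rw [hconj]
    exact (ρ g).strictMono (hright x ((ρ g).lt_iff_lt.mp hy))
  have hpow_fixed : ∀ n : ℕ, ρ ((g * k * g⁻¹) ^ n) q' = q' := by
    intro n
    induction n with
    | zero => simp
    | succ m ih => rw [pow_succ, map_mul, RelIso.mul_apply, hfixed, ih]
  have hpow_le : ∀ (n : ℕ) y, y ≤ ρ ((g * k * g⁻¹) ^ n) y := by
    intro n y
    induction n with
    | zero => simp
    | succ m ih => rw [pow_succ', map_mul, RelIso.mul_apply]; exact ih.trans (hle _)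
  obtain ⟨n, hn⟩ := ((tendsto_pow_apply_atTop (ρ (g * k * g⁻¹)) (x := q' + 1)
    fun y hy => hup y (by linarith)).eventually_gt_atTop (ρ k (q' + 1))).exists
  rw [← map_pow] at hn
  have := hfix.lt_of_crossing (g := (g * k * g⁻¹) ^ n) (h := k) hg (by rw [hq]; exact hpow_le n q)
    (by rw [hpow_fixed]; exact hright q' hg) (lt_add_one q').le
  exact lt_asymm hn this

/-- In a non-abelian group, every nontrivial element with a fixed point is hyperbolic. -/
theorem isExpandingAt_or_inv (hfix : AtMostOneFixedPoint ρ) (hna : ∃ g h : G, g * h ≠ h * g)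
    {g : G} (hg : g ≠ 1) {q : ℝ} (hq : ρ g q = q) :
    IsExpandingAt (ρ g) q ∨ IsExpandingAt (ρ g⁻¹) q := by
  have hinv : ∀ x, ρ g x < x → x < ρ g⁻¹ x := fun x hx => by
    rw [map_inv]; exact lt_inv_apply (by simpa using hx)
  have hinv' : ∀ x, x < ρ g x → ρ g⁻¹ x < x := fun x hx => by
    have := (ρ g⁻¹).strictMono hx
    simpa [← RelIso.mul_apply] using this
  have hq' : ρ g⁻¹ q = q := by
    conv_lhs => rw [← hq]
    simp [← RelIso.mul_apply]
  have hne : ∀ x, ρ g x = x → x = q := fun x hx => hfix g hg x q hx hq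
  rcases lt_or_gt_of_no_fixedPoint (ρ g) (Set.ordConnected_Ioi (a := q))
      (fun x hx h => (ne_of_gt hx) (hne x h)) with hr | hr <;>
    rcases lt_or_gt_of_no_fixedPoint (ρ g) (Set.ordConnected_Iio (a := q))
      (fun x hx h => (ne_of_lt hx) (hne x h)) with hl | hl
  · exact (hfix.not_parabolic hna hq hr hl).elim
  · exact Or.inl ⟨hq, hr, hl⟩
  · exact Or.inr ⟨hq', fun x hx => hinv x (hr x hx), fun x hx => hinv' x (hl x hx)⟩
  · exact (hfix.not_parabolic hna hq' (fun x hx => hinv x (hr x hx))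
      fun x hx => hinv x (hl x hx)).elim

theorem cofinal_of_isExpandingAt (hfix : AtMostOneFixedPoint ρ) {a : G} {q : ℝ}
    (ha : IsExpandingAt (ρ a) q) (g : G) : ∃ n : ℕ, ∀ᶠ x in atTop, ρ g x ≤ ρ (a ^ n) x := by
  have htop := tendsto_pow_apply_atTop (ρ a) (x := q + 1) fun y hy => ha.2.1 y (by linarith)
  have hbot := tendsto_pow_apply_atBot (ρ a) (x := q - 1) fun y hy => ha.2.2 y (by linarith)
  obtain ⟨n, hn₁, hn₂⟩ := ((htop.eventually_gt_atTop (ρ g (q + 1))).and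
    (hbot.eventually_le_atBot (ρ g (q - 1)))).exists
  rw [← map_pow] at hn₁ hn₂
  exact ⟨n, (eventually_ge_atTop (q + 1)).mono fun x hx =>
    (hfix.lt_of_crossing (by linarith) hn₂ hn₁ hx).le⟩

/-- The real homomorphism given by the growth of germs at `+∞`, relative to a hyperbolic element. -/
theorem exists_hom_of_isExpandingAt (hfix : AtMostOneFixedPoint ρ) {a : G} {q : ℝ}
    (ha : IsExpandingAt (ρ a) q) :
    ∃ φ : G → ℝ, (∀ g h, φ (g * h) = φ g + φ h) ∧ φ a = 1 ∧
      (∀ g, (∀ᶠ x in atTop, x ≤ ρ g x) → 0 ≤ φ g) ∧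
      ∀ g p, IsExpandingAt (ρ g) p → 0 < φ g := by
  have hpos : ∀ g p, IsExpandingAt (ρ g) p → ∀ᶠ x in atTop, x ≤ ρ g x := fun g p hg =>
    (eventually_gt_atTop p).mono fun x hx => (hg.2.1 x hx).le
  have ha1 : a ≠ 1 := by
    rintro rfl
    have := ha.2.1 (q + 1) (lt_add_one q)
    simp at this
  obtain ⟨φ, hφ, hφa, hφpos⟩ :=
    hfix.exists_hom_of_cofinal ha1 (hpos a q ha) (hfix.cofinal_of_isExpandingAt ha)
  refine ⟨φ, hφ, hφa, hφpos, fun g p hg => ?_⟩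
  refine lt_of_le_of_ne (hφpos g (hpos g p hg)) fun h0 => ?_
  obtain ⟨n, hn⟩ := hfix.cofinal_of_isExpandingAt hg a
  have := hφpos (g ^ n * a⁻¹) <| ((ρ a⁻¹).tendsto_atTop.eventually hn).mono fun x hx => by
    rwa [← RelIso.mul_apply, ← map_mul, ← RelIso.mul_apply, ← map_mul, mul_inv_cancel, map_one,
      RelIso.one_apply] at hx
  rw [hφ, real_hom_pow hφ, real_hom_inv hφ, ← h0, hφa] at this
  linarith

/-- The elements acting without fixed points, together with the identity, form the kernel of a
nontrivial homomorphism to `ℝ`. -/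
theorem exists_hom_eq_zero_iff (hfix : AtMostOneFixedPoint ρ) (hna : ∃ g h : G, g * h ≠ h * g) :
    ∃ φ : G → ℝ, (∀ g h, φ (g * h) = φ g + φ h) ∧ (∃ a, φ a = 1) ∧
      ∀ g, φ g = 0 ↔ g = 1 ∨ ∀ x, ρ g x ≠ x := by
  obtain ⟨a, q, ha⟩ : ∃ a q, IsExpandingAt (ρ a) q := by
    obtain ⟨a, ha, q, hq⟩ := hfix.exists_fixedPoint hna
    rcases hfix.isExpandingAt_or_inv hna ha hq with h | h
    exacts [⟨a, q, h⟩, ⟨a⁻¹, q, h⟩]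
  obtain ⟨φ, hφ, hφa, hφpos, hφexp⟩ := hfix.exists_hom_of_isExpandingAt ha
  obtain ⟨ψ, hψ, -, hψpos, hψexp'⟩ := hfix.negConj.exists_hom_of_isExpandingAt ha.negConj
  have hψexp : ∀ g p, IsExpandingAt (ρ g) p → 0 < ψ g := fun g p h => hψexp' g (-p) h.negConj
  have hker : ∀ g, φ g = 0 → g = 1 ∨ ∀ x, ρ g x ≠ x := by
    intro g h0
    by_contra! hcon
    obtain ⟨hg, x, hx⟩ := hcon
    rcases hfix.isExpandingAt_or_inv hna hg hx with h | h
    · exact (hφexp g x h).ne' h0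
    · have := hφexp _ x h
      rw [real_hom_inv hφ] at this
      linarith
  have hpos_or : ∀ g : G, (∀ x, ρ g x ≠ x) → (∀ x, x < ρ g x) ∨ ∀ x, x < ρ g⁻¹ x := by
    intro g hg
    refine (lt_or_gt_of_no_fixedPoint (ρ g) Set.ordConnected_univ fun x _ => hg x).imp
      (fun h x => h x trivial) fun h x => ?_
    rw [map_inv]
    exact lt_inv_apply (by simpa using h x trivial)
  obtain ⟨t, htφ, htψ, ht⟩ : ∃ t, φ t = 0 ∧ ψ t = 0 ∧ ∀ x, x < ρ t x := by
    obtain ⟨g, h, hgh⟩ := hna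
    have h₁ := real_hom_commutator hφ g h
    have h₂ := real_hom_commutator hψ g h
    have hfree := (hker _ h₁).resolve_left fun h =>
      hgh (by rwa [mul_inv_eq_one, mul_inv_eq_iff_eq_mul] at h)
    rcases hpos_or _ hfree with h | h
    · exact ⟨_, h₁, h₂, h⟩
    · exact ⟨_, by rw [real_hom_inv hφ, h₁, neg_zero], by rw [real_hom_inv hψ, h₂, neg_zero], h⟩
  have hzero : ∀ h : G, (∀ x, x < ρ h x) → φ h = 0 := by
    intro h hh
    refine le_antisymm ?_ (hφpos h (Eventually.of_forall fun x => (hh x).le))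
    by_contra! hlt
    have hψh : 0 ≤ ψ h⁻¹ := hψpos _ <| Eventually.of_forall fun x => by
      have := hh (ρ h⁻¹ (-x))
      rw [← RelIso.mul_apply, ← map_mul, mul_inv_cancel, map_one, RelIso.one_apply] at this
      rw [MonoidHom.comp_apply, negConj_apply]
      linarith
    have hbound : ∀ n : ℕ, (ρ t ^ n) 0 ≤ ρ h 0 := by
      intro n
      have hφn : φ (h⁻¹ * t ^ n) < 0 := by
        rw [hφ, real_hom_inv hφ, real_hom_pow hφ, htφ]
        linarith
      have hψn : 0 ≤ ψ (h⁻¹ * t ^ n) := by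
        rw [hψ, real_hom_pow hψ, htψ]
        linarith
      have hne : h⁻¹ * t ^ n ≠ 1 := by
        intro h1
        rw [h1, real_hom_one hφ] at hφn
        exact lt_irrefl _ hφn
      have hfree : ∀ x ∈ Set.univ, ρ (h⁻¹ * t ^ n) x ≠ x := by
        intro x _ hx
        rcases hfix.isExpandingAt_or_inv hna hne hx with h' | h'
        · exact lt_asymm hφn (hφexp _ x h')
        · have := hψexp _ x h'
          rw [real_hom_inv hψ] at this
          linarith
      have hdown := (lt_or_gt_of_no_fixedPoint _ Set.ordConnected_univ hfree).resolve_left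
        fun h' => hφn.not_ge (hφpos _ (Eventually.of_forall fun x => (h' x trivial).le))
      have := (ρ h).strictMono (hdown 0 trivial)
      rw [← RelIso.mul_apply, ← map_mul, mul_inv_cancel_left, map_pow] at this
      exact this.le
    obtain ⟨n, hn⟩ := ((tendsto_pow_apply_atTop_of_forall _ ht 0).eventually_gt_atTop
      (ρ h 0)).exists
    exact hn.not_ge (hbound n)
  refine ⟨φ, hφ, ⟨a, hφa⟩, fun g => ⟨hker g, ?_⟩⟩
  rintro (rfl | hg)
  · exact real_hom_one hφ
  · rcases hpos_or g hg with h | h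
    · exact hzero g h
    · have := hzero _ h
      rw [real_hom_inv hφ] at this
      linarith

/-- Linear part `L` and translation part `B` of an affine representation of the group. -/
theorem exists_affine_cocycle (hfix : AtMostOneFixedPoint ρ) (hna : ∃ g h : G, g * h ≠ h * g) :
    ∃ L B : G → ℝ, (∀ g, 0 < L g) ∧ (∀ g h, L (g * h) = L g * L h) ∧
      (∀ g h, B (g * h) = L g * B h + B g) ∧ ∀ g, L g = 1 → B g = 0 → g = 1 := by
  obtain ⟨φ, hφ, ⟨a, hφa⟩, hker⟩ := hfix.exists_hom_eq_zero_iff hna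
  let N : Subgroup G :=
    { carrier := {g | φ g = 0}
      one_mem' := real_hom_one hφ
      mul_mem' := fun {g h} hg hh => by
        change φ (g * h) = 0
        rw [hφ, show φ g = 0 from hg, show φ h = 0 from hh, add_zero]
      inv_mem' := fun {g} hg => by
        change φ g⁻¹ = 0
        rw [real_hom_inv hφ, show φ g = 0 from hg, neg_zero] }
  have hNfree : ∀ n : N, n ≠ 1 → ∀ x, ρ n x ≠ x := fun n hn =>
    ((hker n).mp n.2).resolve_left (by simpa using hn)
  obtain ⟨τ₀, hτ₀, hτ₀pos', hτ₀inj⟩ := (hfix.comp_subtype N).exists_injective_hom_of_free hNfree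
  have hτ₀pos : ∀ n : N, (∀ x, x < ρ n x) → 0 < τ₀ n := by
    intro n hn
    refine lt_of_le_of_ne (hτ₀pos' n (Eventually.of_forall fun x => (hn x).le)) fun h0 => ?_
    have := hn 0
    rw [hτ₀inj n h0.symm] at this
    simp at this
  have hpos_or : ∀ n : N, n ≠ 1 → (∀ x, x < ρ n x) ∨ ∀ x, x < ρ (n⁻¹ : N) x := by
    intro n hn
    refine (lt_or_gt_of_no_fixedPoint (ρ n) Set.ordConnected_univ fun x _ => hNfree n hn x).imp
      (fun h x => h x trivial) fun h x => ?_
    rw [Subgroup.coe_inv, map_inv]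
    exact lt_inv_apply (by simpa using h x trivial)
  obtain ⟨t, ht⟩ : ∃ t : N, ∀ x, x < ρ t x := by
    obtain ⟨g, h, hgh⟩ := hna
    rcases hpos_or ⟨_, real_hom_commutator hφ g h⟩ fun h1 =>
      hgh (by simpa [mul_inv_eq_one, mul_inv_eq_iff_eq_mul] using congrArg Subtype.val h1)
      with h' | h'
    exacts [⟨_, h'⟩, ⟨_, h'⟩]
  have ht₀ := hτ₀pos t ht
  let τ : N → ℝ := fun n => τ₀ n / τ₀ t
  have hτ : ∀ m n, τ (m * n) = τ m + τ n := fun m n => by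
    simp only [τ, hτ₀, add_div]
  have hτt : τ t = 1 := div_self ht₀.ne'
  have hτinj : ∀ n, τ n = 0 → n = 1 := fun n hn =>
    hτ₀inj n ((div_eq_zero_iff.mp hn).resolve_right ht₀.ne')
  have hτpos : ∀ n : N, (∀ x, x < ρ n x) → 0 < τ n := fun n hn => div_pos (hτ₀pos n hn) ht₀
  have hpos_of_τ : ∀ n : N, 0 < τ n → ∀ x, x < ρ n x := by
    intro n hn
    refine (hpos_or n ?_).resolve_right fun h => ?_
    · rintro rfl
      rw [real_hom_one hτ] at hn
      exact lt_irrefl _ hn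
    · have := hτpos _ h
      rw [real_hom_inv hτ] at this
      linarith
  let c : G → N → N := fun g n => ⟨g * n * g⁻¹, by
    have : φ n = 0 := n.2
    change φ _ = 0
    rw [hφ, hφ, real_hom_inv hφ, this]
    ring⟩
  have hc_pos : ∀ g (n : N), (∀ x, x < ρ n x) → ∀ x, x < ρ (c g n) x := by
    intro g n hn x
    have := (ρ g).strictMono (hn (ρ g⁻¹ x))
    rw [← RelIso.mul_apply, ← map_mul, mul_inv_cancel, map_one, RelIso.one_apply] at this
    simp only [c, map_mul, RelIso.mul_apply]
    exact this
  let L : G → ℝ := fun g => τ (c g t)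
  have hc : ∀ g n, τ (c g n) = L g * τ n := fun g =>
    real_hom_proportional hτ (σ := fun n => τ (c g n))
      (fun m n => by
        rw [← hτ]
        congr 1
        ext
        simp [c])
      (fun n hn => (hτpos _ (hc_pos g n (hpos_of_τ n hn))).le) hτt
  have hL_one : ∀ g, L g = 1 → φ g = 0 := by
    intro g hg
    by_contra hne
    have hcomm : c g t = t := by
      have : τ (c g t * t⁻¹) = 0 := by
        rw [hτ, real_hom_inv hτ, hτt, hc, hg, hτt]
        ring
      exact mul_inv_eq_one.mp (hτinj _ this)
    have hcomm' : g * t = t * g := mul_inv_eq_iff_eq_mul.mp (congrArg Subtype.val hcomm)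
    rw [hker] at hne
    push Not at hne
    obtain ⟨hg1, x, hx⟩ := hne
    have hx' : ρ g (ρ t x) = ρ t x := by
      rw [← RelIso.mul_apply, ← map_mul, hcomm', map_mul, RelIso.mul_apply, hx]
    exact (ht x).ne' (hfix g hg1 _ _ hx' hx)
  have hLa : 1 - L a ≠ 0 := fun h => by
    have := hL_one a (by linarith)
    linarith
  let d : G → N := fun g => ⟨g * a * g⁻¹ * a⁻¹, real_hom_commutator hφ g a⟩
  refine ⟨L, fun g => τ (d g) / (1 - L a), fun g => hτpos _ (hc_pos g t ht), fun g h => ?_,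
    fun g h => ?_, fun g hg hB => ?_⟩
  · rw [← hc]
    change τ _ = τ _
    congr 1
    ext
    simp [c, mul_assoc]
  · have : d (g * h) = c g (d h) * d g := by
      ext
      simp [c, d, mul_assoc]
    simp only [this, hτ, hc]
    ring
  · have hgN := hL_one g hg
    let n : N := ⟨g, hgN⟩
    have hd : d g = n * c a n⁻¹ := by
      ext
      simp [c, d, n, mul_assoc]
    simp only [hd, hτ, hc, real_hom_inv hτ] at hB
    have : τ n = 0 := by
      rw [← hB]
      field_simp
      ring
    exact congrArg Subtype.val (hτinj n this)

end AtMostOneFixedPoint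

/-- **Solodov's theorem** (embedding part).  Let `Γ` be a non-abelian group of
orientation-preserving homeomorphisms of the real line (modelled as a subgroup of the
permutation group of `ℝ` all of whose elements are strictly increasing; a strictly
increasing bijection of `ℝ` is exactly an orientation-preserving homeomorphism) such
that every non-identity element of `Γ` has at most one fixed point.  Then `Γ` embeds
into the orientation-preserving affine group of `ℝ`: there is an injective group
homomorphism `ρ` from `Γ` into the permutations of `ℝ` whose values are the maps
`x ↦ a * x + b` with `a > 0`. -/
theorem solodov_embedding
    (Γ : Subgroup (Equiv.Perm ℝ))
    (horient : ∀ γ ∈ Γ, StrictMono γ)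
    (hfix : ∀ γ ∈ Γ, γ ≠ 1 → ∀ x y : ℝ, γ x = x → γ y = y → x = y)
    (hnonab : ∃ γ₁ ∈ Γ, ∃ γ₂ ∈ Γ, γ₁ * γ₂ ≠ γ₂ * γ₁) :
    ∃ ρ : Γ →* Equiv.Perm ℝ, Function.Injective ρ ∧
      ∀ γ : Γ, ∃ a b : ℝ, 0 < a ∧ ∀ x : ℝ, ρ γ x = a * x + b := by
  let ρ : Γ →* (ℝ ≃o ℝ) :=
    { toFun := fun γ =>
        (horient γ γ.2).orderIsoOfSurjective (γ : Equiv.Perm ℝ) (γ : Equiv.Perm ℝ).surjective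
      map_one' := by ext; rfl
      map_mul' := fun _ _ => by ext; rfl }
  have hρ : AtMostOneFixedPoint ρ := fun γ hγ x y hx hy =>
    hfix γ γ.2 (by simpa using hγ) x y hx hy
  have hna : ∃ g h : Γ, g * h ≠ h * g := by
    obtain ⟨g, hg, h, hh, hne⟩ := hnonab
    exact ⟨⟨g, hg⟩, ⟨h, hh⟩, fun heq => hne (congrArg Subtype.val heq)⟩
  obtain ⟨L, B, hL, hLmul, hBmul, hinj⟩ := hρ.exists_affine_cocycle hna
  have hL1 : L 1 = 1 := by
    have := hLmul 1 1
    rw [mul_one] at this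
    exact (mul_eq_left₀ (hL 1).ne').mp this.symm
  have hB1 : B 1 = 0 := by
    have := hBmul 1 1
    rw [mul_one, hL1] at this
    linarith
  let A : Γ →* Equiv.Perm ℝ :=
    { toFun := fun γ =>
        { toFun := fun x => L γ * x + B γ
          invFun := fun x => (x - B γ) / L γ
          left_inv := fun x => by have := (hL γ).ne'; field_simp; ring
          right_inv := fun x => by have := (hL γ).ne'; field_simp; ring }
      map_one' := by ext x; simp [hL1, hB1]
      map_mul' := fun γ δ => by
        ext x
        simp only [hLmul, hBmul, Equiv.coe_fn_mk, Equiv.Perm.mul_apply]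
        ring }
  have hA : ∀ γ x, A γ x = L γ * x + B γ := fun _ _ => rfl
  refine ⟨A, (injective_iff_map_eq_one A).mpr fun γ hγ => ?_, fun γ => ⟨L γ, B γ, hL γ, hA γ⟩⟩
  have h₀ := hA γ 0
  have h₁ := hA γ 1
  rw [hγ, Equiv.Perm.one_apply] at h₀ h₁
  exact hinj γ (by linarith) (by linarith)
end

section
/- Let Γ be a non-abelian group of orientation-preserving homeomorphisms of the real line ℝ such that every element of Γ other than the identity has at most one fixed point. Then there exist an injective group homomorphism ρ from Γ into the orientation-preserving affine group of ℝ and a nondecreasing continuous surjective map h : ℝ → ℝ such that h(γ(x)) = ρ(γ)(h(x)) for every γ ∈ Γ and every x ∈ ℝ (the action of Γ on ℝ is semi-conjugate to the corresponding affine action). -/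
namespace Solodov

open Filter Topology

theorem zpow_strictMono_of_one_lt {G : Type*} [Group G] [LinearOrder G]
    [MulLeftMono G] {u : G} (hu : 1 < u) : StrictMono fun k : ℤ => u ^ k := by
  refine strictMono_int_of_lt_succ fun k => ?_
  rw [zpow_add_one]
  exact lt_mul_of_one_lt_right' _ hu

section BiorderedGroup

variable {G : Type*} [Group G] [LinearOrder G] [MulLeftMono G] [MulRightMono G]

theorem exists_zpow_near {u : G} (hu : 1 < u) (hcof : ∀ g : G, ∃ n : ℕ, g ≤ u ^ n) (g : G) :
    ∃ k : ℤ, u ^ k ≤ g ∧ g < u ^ (k + 1) := by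
  have hmono := zpow_strictMono_of_one_lt hu
  obtain ⟨n, hn⟩ := hcof g
  obtain ⟨m, hm⟩ := hcof g⁻¹
  obtain ⟨k, hk, hmax⟩ := Int.exists_greatest_of_bdd (P := fun k : ℤ => u ^ k ≤ g)
    ⟨n, fun z hz => by
      refine hmono.le_iff_le.1 ?_
      simpa using hz.trans hn⟩
    ⟨-m, by rw [zpow_neg, zpow_natCast]; exact inv_le_of_inv_le' hm⟩
  refine ⟨k, hk, not_le.1 fun h => ?_⟩
  have := hmax _ h
  omega

theorem mul_pow_le_pow_mul_pow {g h : G} (hgh : h * g ≤ g * h) (n : ℕ) :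
    h ^ n * g ^ n ≤ (h * g) ^ n ∧ (g * h) ^ n ≤ g ^ n * h ^ n := by
  have h₁ : ∀ n : ℕ, h * g ^ n ≤ g ^ n * h := fun n => by
    induction n with
    | zero => simp
    | succ n ih =>
      calc h * g ^ (n + 1) = h * g ^ n * g := by rw [pow_succ, mul_assoc]
        _ ≤ g ^ n * h * g := mul_le_mul_left ih _
        _ = g ^ n * (h * g) := mul_assoc _ _ _
        _ ≤ g ^ n * (g * h) := mul_le_mul_right hgh _
        _ = g ^ (n + 1) * h := by rw [pow_succ]; group
  have h₂ : ∀ n : ℕ, h ^ n * g ≤ g * h ^ n := fun n => by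
    induction n with
    | zero => simp
    | succ n ih =>
      calc h ^ (n + 1) * g = h ^ n * (h * g) := by rw [pow_succ, mul_assoc]
        _ ≤ h ^ n * (g * h) := mul_le_mul_right hgh _
        _ = h ^ n * g * h := (mul_assoc _ _ _).symm
        _ ≤ g * h ^ n * h := mul_le_mul_left ih _
        _ = g * h ^ (n + 1) := by rw [pow_succ, mul_assoc]
  induction n with
  | zero => simp
  | succ n ih =>
    constructor
    · calc h ^ (n + 1) * g ^ (n + 1) = h ^ n * (h * g ^ n) * g := by
            rw [pow_succ, pow_succ]; group
        _ ≤ h ^ n * (g ^ n * h) * g := mul_le_mul_left (mul_le_mul_right (h₁ n) _) _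
        _ = h ^ n * g ^ n * (h * g) := by group
        _ ≤ (h * g) ^ n * (h * g) := mul_le_mul_left ih.1 _
        _ = (h * g) ^ (n + 1) := (pow_succ _ _).symm
    · calc (g * h) ^ (n + 1) = (g * h) ^ n * (g * h) := pow_succ _ _
        _ ≤ g ^ n * h ^ n * (g * h) := mul_le_mul_left ih.2 _
        _ = g ^ n * (h ^ n * g) * h := by group
        _ ≤ g ^ n * (g * h ^ n) * h := mul_le_mul_left (mul_le_mul_right (h₂ n) _) _
        _ = g ^ (n + 1) * h ^ (n + 1) := by rw [pow_succ, pow_succ]; group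

/-- A bi-ordered group with a cofinal positive element `u` has a monotone homomorphism to `ℝ`
taking the value `1` at `u`. -/
theorem exists_monotone_hom_real {u : G} (hu : 1 < u) (hcof : ∀ g : G, ∃ n : ℕ, g ≤ u ^ n) :
    ∃ φ : G → ℝ, (∀ a b, φ (a * b) = φ a + φ b) ∧ Monotone φ ∧ φ u = 1 := by
  have hmono := zpow_strictMono_of_one_lt hu
  choose a ha₁ ha₂ using exists_zpow_near hu hcof
  have amono : Monotone a := fun g h hgh =>
    Int.lt_add_one_iff.1 (hmono.lt_iff_lt.1 ((ha₁ g).trans_lt (hgh.trans_lt (ha₂ h))))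
  have amul_ge : ∀ g h, a g + a h ≤ a (g * h) := fun g h => by
    refine Int.lt_add_one_iff.1 (hmono.lt_iff_lt.1 (lt_of_le_of_lt ?_ (ha₂ (g * h))))
    simpa only [zpow_add] using mul_le_mul' (ha₁ g) (ha₁ h)
  have amul_le : ∀ g h, a (g * h) ≤ a g + a h + 1 := fun g h => by
    have : u ^ a (g * h) < u ^ (a g + 1 + (a h + 1)) :=
      (ha₁ (g * h)).trans_lt (by
        rw [zpow_add]; exact mul_lt_mul_of_le_of_lt (ha₂ g).le (ha₂ h))
    have := hmono.lt_iff_lt.1 this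
    omega
  have hsub : ∀ g, Subadditive fun n : ℕ => (a (g ^ n) : ℝ) + 1 := fun g m n => by
    have := amul_le (g ^ m) (g ^ n)
    rw [← pow_add] at this
    have : (a (g ^ (m + n)) : ℝ) ≤ a (g ^ m) + a (g ^ n) + 1 := by exact_mod_cast this
    linarith
  have a_one : a 1 = 0 := by
    have h₁ : a 1 < 0 + 1 := hmono.lt_iff_lt.1 ((ha₁ 1).trans_lt (by simpa using hu))
    have h₂ : 0 < a 1 + 1 := hmono.lt_iff_lt.1 (by simpa using ha₂ 1)
    omega
  have apow_ge : ∀ g, ∀ n : ℕ, (n : ℤ) * a g ≤ a (g ^ n) := fun g n => by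
    induction n with
    | zero => simp [a_one]
    | succ n ih =>
      have := amul_ge (g ^ n) g
      rw [← pow_succ] at this
      push_cast
      linarith
  have hbdd : ∀ g, BddBelow (Set.range fun n : ℕ => ((a (g ^ n) : ℝ) + 1) / n) := fun g => by
    refine ⟨-|(a g : ℝ)|, ?_⟩
    rintro _ ⟨n, rfl⟩
    rcases Nat.eq_zero_or_pos n with rfl | hn
    · simp
    · have hn' : (0 : ℝ) < n := by exact_mod_cast hn
      have h₁ : (n : ℝ) * a g ≤ a (g ^ n) := by exact_mod_cast apow_ge g n
      have h₂ := neg_abs_le (a g : ℝ)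
      simp only
      rw [le_div_iff₀ hn']
      nlinarith
  have hlim := fun g => (hsub g).tendsto_lim (hbdd g)
  refine ⟨fun g => (hsub g).lim, fun g h => ?_, fun g h hgh => ?_, ?_⟩
  · have hbound : ∀ n : ℕ, a (g ^ n) + a (h ^ n) ≤ a ((g * h) ^ n) ∧
        a ((g * h) ^ n) ≤ a (g ^ n) + a (h ^ n) + 1 := fun n => by
      rcases le_total (h * g) (g * h) with hc | hc
      · have h₁ := mul_pow_le_pow_mul_pow hc n
        have h₂ := amono (h₁.1.trans (pow_le_pow_left' hc n))
        have h₃ := amono h₁.2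
        have h₄ := amul_ge (h ^ n) (g ^ n)
        have h₅ := amul_le (g ^ n) (h ^ n)
        constructor <;> omega
      · have h₁ := mul_pow_le_pow_mul_pow hc n
        have h₂ := amono h₁.1
        have h₃ := amono ((pow_le_pow_left' hc n).trans h₁.2)
        have h₄ := amul_ge (g ^ n) (h ^ n)
        have h₅ := amul_le (h ^ n) (g ^ n)
        constructor <;> omega
    have h₀ : Tendsto (fun n : ℕ => (1 : ℝ) / n) atTop (𝓝 0) :=
      tendsto_one_div_atTop_nhds_zero_nat
    have hs := (hlim g).add (hlim h)
    refine le_antisymm ?_ ?_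
    · refine le_of_tendsto_of_tendsto' (hlim (g * h)) hs fun n => ?_
      rw [← add_div]
      have : (a ((g * h) ^ n) : ℝ) ≤ a (g ^ n) + a (h ^ n) + 1 := by exact_mod_cast (hbound n).2
      gcongr ?_ / _
      linarith
    · have := (hlim (g * h)).add h₀
      rw [add_zero] at this
      refine le_of_tendsto_of_tendsto' hs this fun n => ?_
      rw [← add_div, ← add_div]
      have : (a (g ^ n) : ℝ) + a (h ^ n) ≤ a ((g * h) ^ n) := by exact_mod_cast (hbound n).1
      gcongr ?_ / _
      linarith
  · refine le_of_tendsto_of_tendsto' (hlim g) (hlim h) fun n => ?_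
    have : (a (g ^ n) : ℝ) ≤ a (h ^ n) := by exact_mod_cast amono (pow_le_pow_left' hgh n)
    gcongr
  · have hau : ∀ n : ℕ, a (u ^ n) = n := fun n => by
      have h₁ : a (u ^ n) < n + 1 := hmono.lt_iff_lt.1 ((ha₁ _).trans_lt (by
        rw [zpow_add_one, zpow_natCast]; exact lt_mul_of_one_lt_right' _ hu))
      have h₂ : (n : ℤ) < a (u ^ n) + 1 := hmono.lt_iff_lt.1 (by simpa using ha₂ (u ^ n))
      omega
    refine tendsto_nhds_unique (hlim u) ?_
    simp only [hau, Int.cast_natCast]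
    have h₀ : Tendsto (fun n : ℕ => 1 + (1 : ℝ) / n) atTop (𝓝 1) := by
      simpa using tendsto_one_div_atTop_nhds_zero_nat.const_add (1 : ℝ)
    refine h₀.congr' ?_
    filter_upwards [eventually_ne_atTop 0] with n hn
    field_simp

end BiorderedGroup

/-- Two real-valued homomorphisms, the second monotone with respect to the first, are
proportional. -/
theorem hom_eq_mul_of_lt_imp_le {G : Type*} [Group G] {φ ψ : G → ℝ}
    (hφ : ∀ a b, φ (a * b) = φ a + φ b) (hψ : ∀ a b, ψ (a * b) = ψ a + ψ b)
    (hφψ : ∀ a b, φ a < φ b → ψ a ≤ ψ b) {e : G} (he : 0 < φ e) (g : G) :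
    φ e * ψ g = ψ e * φ g := by
  have hone : ∀ χ : G → ℝ, (∀ a b, χ (a * b) = χ a + χ b) → χ 1 = 0 := fun χ hχ => by
    have := hχ 1 1
    rw [mul_one] at this
    linarith
  have hinv : ∀ χ : G → ℝ, (∀ a b, χ (a * b) = χ a + χ b) → ∀ g, χ g⁻¹ = -χ g :=
    fun χ hχ g => by
      have := hχ g g⁻¹
      rw [mul_inv_cancel, hone χ hχ] at this
      linarith
  have hpow : ∀ χ : G → ℝ, (∀ a b, χ (a * b) = χ a + χ b) → ∀ g, ∀ n : ℤ, χ (g ^ n) = n * χ g :=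
    fun χ hχ g n => by
      let f : G →* Multiplicative ℝ := MonoidHom.mk' (fun g => Multiplicative.ofAdd (χ g))
        fun a b => by rw [hχ]; rfl
      have := map_zpow f g n
      have := congrArg Multiplicative.toAdd this
      rw [toAdd_zpow, zsmul_eq_mul] at this
      exact this
  have key : ∀ g, φ e * ψ g ≤ ψ e * φ g := fun g => by
    have hψe : 0 ≤ ψ e := by
      simpa [hone ψ hψ] using hφψ 1 e (by rwa [hone φ hφ])
    have hr : ∀ r : ℚ, φ g / φ e < r → ψ g ≤ r * ψ e := fun r hr => by
      have hd : (0 : ℝ) < r.den := by exact_mod_cast r.pos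
      have hrd : (r : ℝ) = r.num / r.den := Rat.cast_def r
      have := hφψ (g ^ (r.den : ℤ)) (e ^ r.num) (by
        rw [hpow φ hφ, hpow φ hφ]
        rw [hrd, div_lt_div_iff₀ he hd] at hr
        push_cast
        linarith)
      rw [hpow ψ hψ, hpow ψ hψ] at this
      rw [hrd, div_mul_eq_mul_div, le_div_iff₀ hd]
      push_cast at this
      linarith
    by_contra! hlt
    rcases hψe.eq_or_lt with h0 | hpos
    · obtain ⟨r, hr'⟩ := exists_rat_gt (φ g / φ e)
      have := hr r hr'
      rw [← h0] at this hlt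
      nlinarith
    · have : φ g / φ e < ψ g / ψ e := by
        rw [div_lt_div_iff₀ he hpos]; linarith
      obtain ⟨r, hr₁, hr₂⟩ := exists_rat_btwn this
      have h₁ := hr r hr₁
      rw [lt_div_iff₀ hpos] at hr₂
      linarith
  refine le_antisymm (key g) ?_
  have := key g⁻¹
  rw [hinv φ hφ, hinv ψ hψ] at this
  linarith

theorem continuous_of_strictMono {g : Equiv.Perm ℝ} (hg : StrictMono g) : Continuous g :=
  hg.monotone.continuous_of_surjective g.surjective

theorem strictMono_inv {g : Equiv.Perm ℝ} (hg : StrictMono g) :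
    StrictMono (g⁻¹ : Equiv.Perm ℝ) := fun x y hxy => by
  refine hg.lt_iff_lt.1 ?_
  simpa using hxy

theorem tendsto_atTop_of_strictMono {g : Equiv.Perm ℝ} (hg : StrictMono g) :
    Tendsto g atTop atTop :=
  hg.monotone.tendsto_atTop_atTop fun b => ⟨g⁻¹ b, by simp⟩

theorem exists_eq_of_lt_of_lt {f g : Equiv.Perm ℝ} (hf : StrictMono f) (hg : StrictMono g)
    {x y : ℝ} (hxy : x < y) (hx : f x < g x) (hy : g y < f y) :
    ∃ z ∈ Set.Ioo x y, f z = g z := by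
  have hc : ContinuousOn (fun z => f z - g z) (Set.Icc x y) :=
    ((continuous_of_strictMono hf).sub (continuous_of_strictMono hg)).continuousOn
  obtain ⟨z, hz, h⟩ := intermediate_value_Ioo hxy.le hc
    (show (0 : ℝ) ∈ Set.Ioo _ _ from ⟨by linarith, by linarith⟩)
  exact ⟨z, hz, by simpa [sub_eq_zero] using h⟩

theorem pow_apply_eq_iterate (g : Equiv.Perm ℝ) (n : ℕ) (x : ℝ) : (g ^ n) x = g^[n] x := by
  rw [← Equiv.Perm.iterate_eq_pow]

theorem tendsto_pow_apply_atTop {g : Equiv.Perm ℝ} (hg : StrictMono g) {x : ℝ}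
    (h : ∀ y, x ≤ y → y < g y) : Tendsto (fun n : ℕ => (g ^ n) x) atTop atTop := by
  simp only [pow_apply_eq_iterate]
  have hmono : Monotone fun n => g^[n] x :=
    hg.monotone.monotone_iterate_of_le_map (h x le_rfl).le
  rcases tendsto_atTop_of_monotone hmono with ht | ⟨l, hl⟩
  · exact ht
  · have hfix := isFixedPt_of_tendsto_iterate hl (continuous_of_strictMono hg).continuousAt
    exact absurd hfix (h l (hmono.ge_of_tendsto hl 0)).ne'

theorem tendsto_pow_apply_atBot {g : Equiv.Perm ℝ} (hg : StrictMono g) {x : ℝ}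
    (h : ∀ y, y ≤ x → g y < y) : Tendsto (fun n : ℕ => (g ^ n) x) atTop atBot := by
  simp only [pow_apply_eq_iterate]
  have hanti : Antitone fun n => g^[n] x :=
    hg.monotone.antitone_iterate_of_map_le (h x le_rfl).le
  rcases tendsto_atTop_of_antitone hanti with ht | ⟨l, hl⟩
  · exact ht
  · have hfix := isFixedPt_of_tendsto_iterate hl (continuous_of_strictMono hg).continuousAt
    exact absurd hfix (h l (hanti.le_of_tendsto hl 0)).ne

/-- **Hölder's theorem** for a group acting freely on an invariant upper set `S` of the line:
the action is ordered by a homomorphism to `ℝ`. -/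
theorem exists_translation_hom_of_free {G : Type*} [Group G] (act : G →* Equiv.Perm ℝ)
    (hmono : ∀ g, StrictMono (act g)) {S : Set ℝ} (hS : IsUpperSet S) (hne : S.Nonempty)
    (hinv : ∀ g, ∀ x ∈ S, act g x ∈ S) (hfree : ∀ g, g ≠ 1 → ∀ x ∈ S, act g x ≠ x) :
    ∃ φ : G → ℝ, (∀ a b, φ (a * b) = φ a + φ b) ∧
      ∀ a b, ∀ x ∈ S, act a x < act b x ↔ φ a < φ b := by
  obtain ⟨o, ho⟩ := hne
  have eq_of_apply_eq : ∀ a b, ∀ x ∈ S, act a x = act b x → a = b := fun a b x hx hab => by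
    by_contra hne
    refine hfree (b⁻¹ * a) (fun h => hne (inv_mul_eq_one.1 h).symm) x hx ?_
    simp [hab]
  have lt_of_lt : ∀ a b, ∀ x ∈ S, act a x < act b x → ∀ y ∈ S, act a y < act b y := by
    intro a b x hx hab y hy
    by_contra! hle
    rcases hle.eq_or_lt with heq | hlt
    · rw [eq_of_apply_eq b a y hy heq] at hab
      exact lt_irrefl _ hab
    · rcases lt_trichotomy x y with hxy | rfl | hxy
      · obtain ⟨z, hz, h⟩ := exists_eq_of_lt_of_lt (hmono a) (hmono b) hxy hab hlt
        rw [eq_of_apply_eq a b z (hS hz.1.le hx) h] at hab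
        exact lt_irrefl _ hab
      · exact lt_asymm hab hlt
      · obtain ⟨z, hz, h⟩ := exists_eq_of_lt_of_lt (hmono b) (hmono a) hxy hlt hab
        rw [eq_of_apply_eq b a z (hS hz.1.le hy) h] at hab
        exact lt_irrefl _ hab
  let _ : LinearOrder G := LinearOrder.lift' (fun g => act g o) fun a b => eq_of_apply_eq a b o ho
  have le_def : ∀ a b : G, a ≤ b ↔ act a o ≤ act b o := fun a b => Iff.rfl
  have lt_def : ∀ a b : G, a < b ↔ act a o < act b o := fun a b => Iff.rfl
  have : MulLeftMono G := ⟨fun c a b hab => by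
    rw [le_def] at hab ⊢
    simpa using (hmono c).monotone hab⟩
  have : MulRightMono G := ⟨fun c a b hab => by
    rcases hab.eq_or_lt with rfl | hlt
    · exact le_rfl
    · rw [lt_def] at hlt
      rw [le_def]
      simpa [Function.swap] using (lt_of_lt a b o ho hlt _ (hinv c o ho)).le⟩
  have hcof : ∀ e : G, 1 < e → ∀ g : G, ∃ n : ℕ, g ≤ e ^ n := fun e he g => by
    rw [lt_def] at he
    have ht := tendsto_pow_apply_atTop (hmono e) (x := o) fun y hy => by
      simpa using lt_of_lt 1 e o ho he y (hS hy ho)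
    obtain ⟨n, hn⟩ := (ht.eventually_ge_atTop (act g o)).exists
    exact ⟨n, by rw [le_def, map_pow]; exact hn⟩
  by_cases hex : ∃ u : G, 1 < u
  · obtain ⟨u, hu⟩ := hex
    obtain ⟨φ, hφ, φmono, hφu⟩ := exists_monotone_hom_real hu (hcof u hu)
    have h1 : φ 1 = 0 := by
      have := hφ 1 1
      rw [mul_one] at this
      linarith
    have hpos : ∀ e : G, 1 < e → 0 < φ e := fun e he => by
      obtain ⟨n, hn⟩ := hcof e he u
      have hpow : φ (e ^ n) = n * φ e := by
        clear hn
        induction n with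
        | zero => simp [h1]
        | succ n ih => rw [pow_succ, hφ, ih]; push_cast; ring
      have := φmono hn
      rw [hφu, hpow] at this
      by_contra! hle
      nlinarith [Nat.cast_nonneg (α := ℝ) n]
    have hstrict : StrictMono φ := fun a b hab => by
      have := hpos (a⁻¹ * b) (by
        refine lt_of_le_of_ne ?_ fun h => hab.ne (inv_mul_eq_one.1 h.symm)
        simpa using mul_le_mul_right hab.le a⁻¹)
      have h := hφ a (a⁻¹ * b)
      rw [mul_inv_cancel_left] at h
      linarith
    refine ⟨φ, hφ, fun a b x hx => ?_⟩
    rw [hstrict.lt_iff_lt, lt_def]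
    exact ⟨fun h => lt_of_lt a b x hx h o ho, fun h => lt_of_lt a b o ho h x hx⟩
  · have htriv : ∀ g : G, g = 1 := fun g => by
      refine le_antisymm (not_lt.1 fun h => hex ⟨g, h⟩) (not_lt.1 fun h => hex ⟨g⁻¹, ?_⟩)
      refine lt_of_le_of_ne ?_ fun h' => h.ne (inv_eq_one.1 h'.symm)
      simpa using mul_le_mul_right h.le g⁻¹
    refine ⟨fun _ => 0, fun _ _ => by simp, fun a b x _ => ?_⟩
    rw [htriv a, htriv b]
    simp

theorem mul_comm_of_free {G : Type*} [Group G] (act : G →* Equiv.Perm ℝ)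
    (hmono : ∀ g, StrictMono (act g)) {S : Set ℝ} (hS : IsUpperSet S) (hne : S.Nonempty)
    (hinv : ∀ g, ∀ x ∈ S, act g x ∈ S) (hfree : ∀ g, g ≠ 1 → ∀ x ∈ S, act g x ≠ x) (a b : G) :
    a * b = b * a := by
  obtain ⟨φ, hφ, hlt⟩ := exists_translation_hom_of_free act hmono hS hne hinv hfree
  obtain ⟨x, hx⟩ := hne
  have heq : φ (a * b) = φ (b * a) := by rw [hφ, hφ, add_comm]
  have hfix : act (a * b) x = act (b * a) x :=
    le_antisymm (not_lt.1 fun h => ((hlt _ _ x hx).1 h).ne' heq)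
      (not_lt.1 fun h => ((hlt _ _ x hx).1 h).ne heq)
  by_contra hne
  refine hfree ((b * a)⁻¹ * (a * b)) (fun h => hne (inv_mul_eq_one.1 h).symm) x hx ?_
  rw [map_mul, Equiv.Perm.mul_apply, hfix, ← Equiv.Perm.mul_apply, ← map_mul]
  simp

theorem eq_of_apply_eq_of_apply_eq {Γ : Subgroup (Equiv.Perm ℝ)}
    (hfix : ∀ γ ∈ Γ, γ ≠ 1 → ∀ x y : ℝ, γ x = x → γ y = y → x = y) {f g : Equiv.Perm ℝ}
    (hf : f ∈ Γ) (hg : g ∈ Γ) {x y : ℝ} (hxy : x ≠ y) (hx : f x = g x) (hy : f y = g y) :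
    f = g := by
  by_contra hne
  refine hxy (hfix (g⁻¹ * f) (mul_mem (inv_mem hg) hf)
    (fun h => hne (inv_mul_eq_one.1 h).symm) x y ?_ ?_)
  · simp [hx]
  · simp [hy]

theorem not_alternating {Γ : Subgroup (Equiv.Perm ℝ)} (horient : ∀ γ ∈ Γ, StrictMono γ)
    (hfix : ∀ γ ∈ Γ, γ ≠ 1 → ∀ x y : ℝ, γ x = x → γ y = y → x = y)
    {f g : Equiv.Perm ℝ} (hf : f ∈ Γ) (hg : g ∈ Γ) {x y z : ℝ}
    (hxy : x < y) (hyz : y < z) (hx : f x < g x) (hy : g y < f y) (hz : f z < g z) : False := by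
  obtain ⟨v, hv, hv'⟩ := exists_eq_of_lt_of_lt (horient f hf) (horient g hg) hxy hx hy
  obtain ⟨w, hw, hw'⟩ := exists_eq_of_lt_of_lt (horient g hg) (horient f hf) hyz hy hz
  have := eq_of_apply_eq_of_apply_eq hfix hf hg (hv.2.trans hw.1).ne hv' hw'.symm
  rw [this] at hx
  exact lt_irrefl _ hx

theorem not_parabolic {Γ : Subgroup (Equiv.Perm ℝ)} (horient : ∀ γ ∈ Γ, StrictMono γ)
    (hfix : ∀ γ ∈ Γ, γ ≠ 1 → ∀ x y : ℝ, γ x = x → γ y = y → x = y)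
    (hglob : ∀ p : ℝ, ∃ g ∈ Γ, g p ≠ p) {f : Equiv.Perm ℝ} (hf : f ∈ Γ) {p : ℝ}
    (hp : f p = p) (hlt : ∀ x, x ≠ p → x < f x) : False := by
  obtain ⟨g, hg, hgp⟩ : ∃ g ∈ Γ, p < g p := by
    obtain ⟨g, hg, hgp⟩ := hglob p
    rcases lt_or_gt_of_ne hgp with h | h
    · refine ⟨g⁻¹, inv_mem hg, ?_⟩
      refine (horient g hg).lt_iff_lt.1 ?_
      simpa using h
    · exact ⟨g, hg, h⟩
  set q := g p with hq
  set f' := g * f * g⁻¹ with hf'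
  have hf'Γ : f' ∈ Γ := mul_mem (mul_mem hg hf) (inv_mem hg)
  have hf'q : f' q = q := by simp [hf', hq, hp]
  have hf'lt : ∀ x, x ≠ q → x < f' x := fun x hx => by
    have := hlt (g⁻¹ x) (fun h => hx (by rw [hq, ← h]; simp))
    simpa [hf'] using horient g hg this
  have ht := tendsto_pow_apply_atTop (horient f' hf'Γ) (x := q + 1) fun y hy =>
    hf'lt y (by linarith)
  have ht' : Tendsto (fun n : ℕ => (f' ^ (n + 1)) (q + 1)) atTop atTop :=
    (tendsto_add_atTop_iff_nat 1).2 ht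
  obtain ⟨n, hn⟩ := (ht'.eventually_gt_atTop (f (q + 1))).exists
  have hFq : ∀ n : ℕ, (f' ^ n) q = q := fun n => by
    induction n with
    | zero => simp
    | succ n ih => rw [pow_succ, Equiv.Perm.mul_apply, hf'q, ih]
  have hFp : ∀ n : ℕ, p < (f' ^ (n + 1)) p := fun n => by
    induction n with
    | zero => simpa using hf'lt p hgp.ne
    | succ n ih =>
      rw [pow_succ', Equiv.Perm.mul_apply]
      exact (hf'lt p hgp.ne).trans (horient f' hf'Γ ih)
  refine not_alternating horient hfix hf (pow_mem hf'Γ (n + 1)) hgp (lt_add_one q) ?_ ?_ hn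
  · rw [hp]; exact hFp n
  · rw [hFq]; exact hlt q hgp.ne'

/-- A nontrivial element with a fixed point is expanding or contracting there. -/
theorem expanding_or_inv_expanding {Γ : Subgroup (Equiv.Perm ℝ)} (horient : ∀ γ ∈ Γ, StrictMono γ)
    (hfix : ∀ γ ∈ Γ, γ ≠ 1 → ∀ x y : ℝ, γ x = x → γ y = y → x = y)
    (hglob : ∀ p : ℝ, ∃ g ∈ Γ, g p ≠ p) {f : Equiv.Perm ℝ}
    (hf : f ∈ Γ) (hf1 : f ≠ 1) {p : ℝ} (hp : f p = p) :
    ((∀ x, p < x → x < f x) ∧ ∀ x, x < p → f x < x) ∨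
      ((∀ x, p < x → x < f⁻¹ x) ∧ ∀ x, x < p → f⁻¹ x < x) := by
  have hne : ∀ x, x ≠ p → f x ≠ x := fun x hx h => hx (hfix f hf hf1 x p h hp)
  have hmono := horient f hf
  have h1 : StrictMono (1 : Equiv.Perm ℝ) := strictMono_id
  have hsame : ∀ x y, x < y → (p < x ∨ y < p) → (x < f x ↔ y < f y) := by
    intro x y hxy hp'
    have hxp : x ≠ p := by rintro rfl; rcases hp' with h | h <;> linarith
    have hyp : y ≠ p := by rintro rfl; rcases hp' with h | h <;> linarith
    constructor
    · intro hx
      by_contra! hy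
      obtain ⟨z, hz, h⟩ := exists_eq_of_lt_of_lt h1 hmono hxy hx (hy.lt_of_ne (hne y hyp))
      refine hne z ?_ h.symm
      rintro rfl
      rcases hp' with h | h
      · exact lt_asymm h hz.1
      · exact lt_asymm h hz.2
    · intro hy
      by_contra! hx
      obtain ⟨z, hz, h⟩ := exists_eq_of_lt_of_lt hmono h1 hxy (hx.lt_of_ne (hne x hxp)) hy
      refine hne z ?_ h
      rintro rfl
      rcases hp' with h | h
      · exact lt_asymm h hz.1
      · exact lt_asymm h hz.2
  have hright : ∀ x, p < x → (x < f x ↔ p + 1 < f (p + 1)) := fun x hx => by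
    rcases lt_trichotomy x (p + 1) with h | rfl | h
    · exact hsame _ _ h (Or.inl hx)
    · rfl
    · exact (hsame _ _ h (Or.inl (lt_add_one p))).symm
  have hleft : ∀ x, x < p → (x < f x ↔ p - 1 < f (p - 1)) := fun x hx => by
    rcases lt_trichotomy x (p - 1) with h | rfl | h
    · exact hsame _ _ h (Or.inr (by linarith))
    · rfl
    · exact (hsame _ _ h (Or.inr hx)).symm
  have hge : ∀ x, x ≠ p → ¬ x < f x → f x < x := fun x hx h => (not_lt.1 h).lt_of_ne (hne x hx)
  have hinv_gt : ∀ x, f x < x → x < f⁻¹ x := fun x hx => hmono.lt_iff_lt.1 (by simpa using hx)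
  have hinv_lt : ∀ x, x < f x → f⁻¹ x < x := fun x hx => hmono.lt_iff_lt.1 (by simpa using hx)
  by_cases hR : p + 1 < f (p + 1) <;> by_cases hL : p - 1 < f (p - 1)
  · exfalso
    refine not_parabolic horient hfix hglob hf hp fun x hx => ?_
    rcases lt_or_gt_of_ne hx with h | h
    · exact (hleft x h).2 hL
    · exact (hright x h).2 hR
  · exact Or.inl ⟨fun x hx => (hright x hx).2 hR,
      fun x hx => hge x hx.ne fun h => hL ((hleft x hx).1 h)⟩
  · exact Or.inr ⟨fun x hx => hinv_gt x (hge x hx.ne' fun h => hR ((hright x hx).1 h)),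
      fun x hx => hinv_lt x ((hleft x hx).2 hL)⟩
  · exfalso
    refine not_parabolic horient hfix hglob (inv_mem hf) (p := p)
      (by rw [Equiv.Perm.inv_eq_iff_eq, hp]) fun x hx => hinv_gt x ?_
    rcases lt_or_gt_of_ne hx with h | h
    · exact hge x hx fun h' => hL ((hleft x h).1 h')
    · exact hge x hx fun h' => hR ((hright x h).1 h')

/-- There is a homomorphism to `ℝ`, monotone for the order of germs at `+∞`, which vanishes on no
nontrivial element with a fixed point. -/
theorem exists_hom_ne_zero_of_fixed {Γ : Subgroup (Equiv.Perm ℝ)} (horient : ∀ γ ∈ Γ, StrictMono γ)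
    (hfix : ∀ γ ∈ Γ, γ ≠ 1 → ∀ x y : ℝ, γ x = x → γ y = y → x = y)
    (hglob : ∀ p : ℝ, ∃ g ∈ Γ, g p ≠ p)
    (hex : ∃ k ∈ Γ, k ≠ 1 ∧ ∃ p, k p = p) :
    ∃ φ : Γ → ℝ, (∀ a b, φ (a * b) = φ a + φ b) ∧
      ∀ a : Γ, a ≠ 1 → ∀ p : ℝ, (a : Equiv.Perm ℝ) p = p → φ a ≠ 0 := by
  let le : Γ → Γ → Prop := fun a b =>
    ∀ᶠ x in atTop, (a : Equiv.Perm ℝ) x ≤ (b : Equiv.Perm ℝ) x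
  let _ : LinearOrder Γ :=
    { le := le
      le_refl := fun a => Eventually.of_forall fun x => le_rfl
      le_trans := fun a b c hab hbc => by
        filter_upwards [hab, hbc] with x h₁ h₂ using h₁.trans h₂
      le_antisymm := fun a b hab hba => by
        have h := hab.and hba
        obtain ⟨N, hN⟩ := eventually_atTop.1 h
        have heq : ∀ x ≥ N, (a : Equiv.Perm ℝ) x = (b : Equiv.Perm ℝ) x := fun x hx =>
          le_antisymm (hN x hx).1 (hN x hx).2
        exact Subtype.ext (eq_of_apply_eq_of_apply_eq hfix a.2 b.2 (lt_add_one N).ne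
          (heq N le_rfl) (heq (N + 1) (by linarith)))
      le_total := fun a b => by
        by_contra! h
        obtain ⟨hab, hba⟩ := h
        simp only [le, not_eventually, not_le] at hab hba
        obtain ⟨x, -, hx⟩ := frequently_atTop'.1 hab 0
        obtain ⟨y, hxy, hy⟩ := frequently_atTop'.1 hba x
        obtain ⟨z, hyz, hz⟩ := frequently_atTop'.1 hab y
        exact not_alternating horient hfix b.2 a.2 hxy hyz hx hy hz
      toDecidableLE := Classical.decRel _ }
  have le_def : ∀ a b : Γ, a ≤ b ↔
      ∀ᶠ x in atTop, (a : Equiv.Perm ℝ) x ≤ (b : Equiv.Perm ℝ) x := fun a b => Iff.rfl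
  have : MulLeftMono Γ := ⟨fun c a b hab => by
    rw [le_def] at hab ⊢
    filter_upwards [hab] with x hx
    simpa using (horient c c.2).monotone hx⟩
  have : MulRightMono Γ := ⟨fun c a b hab => by
    rw [le_def] at hab
    have := (tendsto_atTop_of_strictMono (horient c c.2)).eventually hab
    rw [le_def]
    simpa [Function.swap] using this⟩
  have hone_lt : ∀ k : Γ, ∀ p : ℝ, (∀ x, p < x → x < (k : Equiv.Perm ℝ) x) → 1 < k := by
    intro k p hk
    refine lt_of_le_of_ne ?_ ?_
    · rw [le_def]
      filter_upwards [eventually_gt_atTop p] with x hx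
      simpa using (hk x hx).le
    · rintro rfl
      simpa using hk (p + 1) (lt_add_one p)
  have hcof : ∀ k : Γ, ∀ p : ℝ, (∀ x, p < x → x < (k : Equiv.Perm ℝ) x) →
      (∀ x, x < p → (k : Equiv.Perm ℝ) x < x) → ∀ g : Γ, ∃ n : ℕ, g ≤ k ^ n := by
    intro k p hR hL g
    have ht := tendsto_pow_apply_atTop (horient k k.2) (x := p + 1) fun y hy =>
      hR y (by linarith)
    have hb := tendsto_pow_apply_atBot (horient k k.2) (x := p - 1) fun y hy =>
      hL y (by linarith)
    obtain ⟨n, hn₁, hn₂⟩ := ((ht.eventually_gt_atTop ((g : Equiv.Perm ℝ) (p + 1))).and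
      (hb.eventually_lt_atBot ((g : Equiv.Perm ℝ) (p - 1)))).exists
    refine ⟨n, ?_⟩
    rw [le_def]
    filter_upwards [eventually_gt_atTop (p + 1)] with z hz
    by_contra! hlt
    refine not_alternating horient hfix (pow_mem k.2 n) g.2 (by linarith) hz hn₂ hn₁ ?_
    simpa using hlt
  have hexp : ∀ k : Γ, k ≠ 1 → ∀ p : ℝ, (k : Equiv.Perm ℝ) p = p →
      ∃ u : Γ, (u = k ∨ u = k⁻¹) ∧ 1 < u ∧ ∀ g : Γ, ∃ n : ℕ, g ≤ u ^ n := by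
    intro k hk p hp
    have hk' : (k : Equiv.Perm ℝ) ≠ 1 := fun h => hk (Subtype.ext h)
    rcases expanding_or_inv_expanding horient hfix hglob k.2 hk' hp with ⟨hR, hL⟩ | ⟨hR, hL⟩
    · exact ⟨k, Or.inl rfl, hone_lt k p hR, hcof k p hR hL⟩
    · exact ⟨k⁻¹, Or.inr rfl, hone_lt k⁻¹ p hR, hcof k⁻¹ p hR hL⟩
  obtain ⟨k, hkΓ, hk, p, hp⟩ := hex
  obtain ⟨u, -, hu, hucof⟩ := hexp ⟨k, hkΓ⟩ (fun h => hk (congrArg Subtype.val h)) p hp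
  obtain ⟨φ, hφ, φmono, hφu⟩ := exists_monotone_hom_real hu hucof
  have h1 : φ 1 = 0 := by
    have := hφ 1 1
    rw [mul_one] at this
    linarith
  refine ⟨φ, hφ, fun a ha q hq h0 => ?_⟩
  obtain ⟨v, hv, -, hvcof⟩ := hexp a ha q hq
  have hv0 : φ v = 0 := by
    rcases hv with rfl | rfl
    · exact h0
    · have := hφ a a⁻¹
      rw [mul_inv_cancel, h1, h0] at this
      linarith
  have hpow : ∀ n : ℕ, φ (v ^ n) = 0 := fun n => by
    induction n with
    | zero => simpa using h1
    | succ n ih => rw [pow_succ, hφ, ih, hv0, add_zero]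
  obtain ⟨n, hn⟩ := hvcof u
  have := φmono hn
  rw [hφu, hpow] at this
  linarith

theorem exists_forall_ge_lt_apply {Γ : Subgroup (Equiv.Perm ℝ)} (horient : ∀ γ ∈ Γ, StrictMono γ)
    (hfix : ∀ γ ∈ Γ, γ ≠ 1 → ∀ x y : ℝ, γ x = x → γ y = y → x = y)
    {f : Equiv.Perm ℝ}
    (hf : f ∈ Γ) (hf1 : f ≠ 1) :
    ∃ N : ℝ, (∀ x, N ≤ x → x < f x) ∨ ∀ x, N ≤ x → x < f⁻¹ x := by
  have hmono := horient f hf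
  have h1 : StrictMono (1 : Equiv.Perm ℝ) := strictMono_id
  obtain ⟨N, hN⟩ : ∃ N : ℝ, ∀ x, N ≤ x → f x ≠ x := by
    by_cases h : ∃ p, f p = p
    · obtain ⟨p, hp⟩ := h
      exact ⟨p + 1, fun x hx hfx => by have := hfix f hf hf1 x p hfx hp; linarith⟩
    · exact ⟨0, fun x _ hx => h ⟨x, hx⟩⟩
  refine ⟨N, ?_⟩
  rcases lt_or_gt_of_ne (hN N le_rfl) with h | h
  · right
    intro x hx
    refine hmono.lt_iff_lt.1 ?_
    by_contra! hlt
    have hx' : x < f x := lt_of_le_of_ne (by simpa using hlt) (hN x hx).symm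
    have hNx : N < x := lt_of_le_of_ne hx (by rintro rfl; exact lt_asymm h hx')
    obtain ⟨z, hz, hz'⟩ := exists_eq_of_lt_of_lt hmono h1 hNx h hx'
    exact hN z hz.1.le hz'
  · left
    intro x hx
    by_contra! hlt
    have hx' : f x < x := lt_of_le_of_ne hlt (hN x hx)
    have hNx : N < x := lt_of_le_of_ne hx (by rintro rfl; exact lt_asymm h hx')
    obtain ⟨z, hz, hz'⟩ := exists_eq_of_lt_of_lt h1 hmono hNx h hx'
    exact hN z hz.1.le hz'.symm

/-- A group of homeomorphisms ordered by a homomorphism with dense image in `ℝ` is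
semi-conjugate to a group of translations. -/
theorem exists_semiconj_translation {M : Type*} [Group M] (act : M →* Equiv.Perm ℝ)
    (hmono : ∀ m, StrictMono (act m)) {φ : M → ℝ} (hφ : ∀ a b, φ (a * b) = φ a + φ b)
    (hlt : ∀ a b x, act a x < act b x ↔ φ a < φ b) (hdense : DenseRange φ) :
    ∃ h : ℝ → ℝ, Monotone h ∧ Continuous h ∧ Function.Surjective h ∧
      ∀ m x, h (act m x) = h x + φ m := by
  have hone : φ 1 = 0 := by
    have := hφ 1 1
    rw [mul_one] at this
    linarith
  have hinv : ∀ m, φ m⁻¹ = -φ m := fun m => by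
    have := hφ m m⁻¹
    rw [mul_inv_cancel, hone] at this
    linarith
  obtain ⟨e, he⟩ : ∃ e, 0 < φ e :=
    hdense.exists_mem_open isOpen_Ioi ⟨(1 : ℝ), zero_lt_one' ℝ⟩
  have he_lt : ∀ x, x < act e x := fun x => by
    have := (hlt 1 e x).2 (by rw [hone]; exact he)
    simpa using this
  have he_gt : ∀ x, act e⁻¹ x < x := fun x => by
    have := (hlt e⁻¹ 1 x).2 (by rw [hone, hinv]; exact neg_lt_zero.2 he)
    simpa using this
  have hup : ∀ x, ∃ m, x < act m 0 := fun x => by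
    obtain ⟨n, hn⟩ := ((tendsto_pow_apply_atTop (hmono e) (x := 0) fun y _ =>
      he_lt y).eventually_gt_atTop x).exists
    exact ⟨e ^ n, by rw [map_pow]; exact hn⟩
  have hdown : ∀ x, ∃ m, act m 0 ≤ x := fun x => by
    obtain ⟨n, hn⟩ := ((tendsto_pow_apply_atBot (hmono e⁻¹) (x := 0) fun y _ =>
      he_gt y).eventually_le_atBot x).exists
    exact ⟨e⁻¹ ^ n, by rw [map_pow]; exact hn⟩
  let A : ℝ → Set ℝ := fun x => φ '' {m | act m 0 ≤ x}
  have hne : ∀ x, (A x).Nonempty := fun x => by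
    obtain ⟨m, hm⟩ := hdown x
    exact ⟨φ m, m, hm, rfl⟩
  have hbdd : ∀ x, BddAbove (A x) := fun x => by
    obtain ⟨m, hm⟩ := hup x
    refine ⟨φ m, ?_⟩
    rintro _ ⟨m', hm', rfl⟩
    exact ((hlt m' m 0).1 (lt_of_le_of_lt hm' hm)).le
  let h : ℝ → ℝ := fun x => sSup (A x)
  have h_mono : Monotone h := fun x y hxy =>
    csSup_le_csSup (hbdd y) (hne x) (Set.image_mono fun m hm => le_trans hm hxy)
  have hge : ∀ m x, h x + φ m ≤ h (act m x) := fun m x => by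
    rw [← le_sub_iff_add_le]
    refine csSup_le (hne x) ?_
    rintro _ ⟨m', hm', rfl⟩
    rw [le_sub_iff_add_le, add_comm, ← hφ]
    refine le_csSup (hbdd _) ⟨m * m', ?_, rfl⟩
    simpa using (hmono m).monotone hm'
  have hequiv : ∀ m x, h (act m x) = h x + φ m := fun m x => by
    refine le_antisymm ?_ (hge m x)
    have := hge m⁻¹ (act m x)
    rw [hinv] at this
    have hx : act m⁻¹ (act m x) = x := by simp
    rw [hx] at this
    linarith
  have h_cont : Continuous h := by
    refine h_mono.continuous_of_denseRange ?_
    have hd : DenseRange fun m => h 0 + φ m :=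
      (Homeomorph.addLeft (h 0)).surjective.denseRange.comp hdense
        (Homeomorph.addLeft (h 0)).continuous
    refine hd.mono ?_
    rintro _ ⟨m, rfl⟩
    exact ⟨act m 0, hequiv m 0⟩
  refine ⟨h, h_mono, h_cont, fun y => ?_, hequiv⟩
  obtain ⟨b, hb⟩ : ∃ b, y - h 0 < φ b :=
    hdense.exists_mem_open isOpen_Ioi ⟨_, lt_add_one (y - h 0)⟩
  obtain ⟨a, ha⟩ : ∃ a, φ a < y - h 0 :=
    hdense.exists_mem_open isOpen_Iio ⟨_, sub_one_lt (y - h 0)⟩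
  exact mem_range_of_exists_le_of_exists_ge h_cont
    ⟨act a 0, by rw [hequiv]; linarith⟩ ⟨act b 0, by rw [hequiv]; linarith⟩

/-- A monotone map which rescales the translations commuting with `h` acts affinely through `h`. -/
theorem affine_of_rescale {M : Type*} [Group M] (act : M →* Equiv.Perm ℝ) {φ : M → ℝ}
    (hdense : DenseRange φ) {h : ℝ → ℝ} (h_mono : Monotone h)
    (hequiv : ∀ m x, h (act m x) = h x + φ m) {H : ℝ → ℝ} (H_mono : Monotone H) {l : ℝ}
    (hl : 0 < l) (Hequiv : ∀ m x, H (act m x) = H x + l * φ m) (x : ℝ) :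
    H x = l * h x + (H 0 - l * h 0) := by
  refine le_antisymm (le_of_forall_pos_lt_add fun ε hε => ?_)
    (le_of_forall_pos_lt_add fun ε hε => ?_)
  · obtain ⟨_, ⟨m, rfl⟩, hm₁, hm₂⟩ := hdense.exists_between
      (show h x - h 0 < h x - h 0 + ε / l by linarith [div_pos hε hl])
    have hlt : x < act m 0 := h_mono.reflect_lt (by rw [hequiv]; linarith)
    have := H_mono hlt.le
    rw [Hequiv] at this
    have h₂ := mul_lt_mul_of_pos_left hm₂ hl
    have h₃ : l * (ε / l) = ε := by field_simp
    nlinarith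
  · obtain ⟨_, ⟨m, rfl⟩, hm₁, hm₂⟩ := hdense.exists_between
      (show h x - h 0 - ε / l < h x - h 0 by linarith [div_pos hε hl])
    have hlt : act m 0 < x := h_mono.reflect_lt (by rw [hequiv]; linarith)
    have := H_mono hlt.le
    rw [Hequiv] at this
    have h₂ := mul_lt_mul_of_pos_left hm₁ hl
    have h₃ : l * (ε / l) = ε := by field_simp
    nlinarith

/-- The affine permutation `x ↦ a * x + b`. -/
noncomputable def affinePerm (a b : ℝ) (ha : 0 < a) : Equiv.Perm ℝ where
  toFun x := a * x + b
  invFun y := (y - b) / a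
  left_inv x := by field_simp; ring
  right_inv y := by field_simp; ring

theorem exists_ne_one_fixed {Γ : Subgroup (Equiv.Perm ℝ)} (horient : ∀ γ ∈ Γ, StrictMono γ)
    (hnonab : ∃ γ₁ ∈ Γ, ∃ γ₂ ∈ Γ, γ₁ * γ₂ ≠ γ₂ * γ₁) :
    ∃ k ∈ Γ, k ≠ 1 ∧ ∃ p, k p = p := by
  by_contra! hfree
  obtain ⟨a, ha, b, hb, hab⟩ := hnonab
  refine hab (congrArg Subtype.val (mul_comm_of_free Γ.subtype (fun g => horient g g.2)
    isUpperSet_univ Set.univ_nonempty (fun _ _ _ => trivial) (fun g hg x _ => ?_)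
    ⟨a, ha⟩ ⟨b, hb⟩))
  exact hfree g g.2 (fun h => hg (Subtype.ext h)) x

theorem exists_apply_ne {Γ : Subgroup (Equiv.Perm ℝ)} (horient : ∀ γ ∈ Γ, StrictMono γ)
    (hfix : ∀ γ ∈ Γ, γ ≠ 1 → ∀ x y : ℝ, γ x = x → γ y = y → x = y)
    (hnonab : ∃ γ₁ ∈ Γ, ∃ γ₂ ∈ Γ, γ₁ * γ₂ ≠ γ₂ * γ₁)
    (p : ℝ) : ∃ g ∈ Γ, g p ≠ p := by
  by_contra! hglob
  obtain ⟨a, ha, b, hb, hab⟩ := hnonab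
  refine hab (congrArg Subtype.val (mul_comm_of_free Γ.subtype (fun g => horient g g.2)
    (isUpperSet_Ioi p) ⟨p + 1, lt_add_one p⟩ (fun g x hx => ?_) (fun g hg x hx h => ?_)
    ⟨a, ha⟩ ⟨b, hb⟩))
  · have := horient g g.2 (Set.mem_Ioi.1 hx)
    rw [hglob g g.2] at this
    exact this
  · exact (Set.mem_Ioi.1 hx).ne
      (hfix g g.2 (fun h => hg (Subtype.ext h)) p x (hglob g g.2) h)

/-- The group contains a normal subgroup ordered by a homomorphism to `ℝ` with dense image, which
is rescaled by conjugation. -/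
theorem exists_normal_translation_subgroup {Γ : Subgroup (Equiv.Perm ℝ)}
    (horient : ∀ γ ∈ Γ, StrictMono γ)
    (hfix : ∀ γ ∈ Γ, γ ≠ 1 → ∀ x y : ℝ, γ x = x → γ y = y → x = y)
    (hnonab : ∃ γ₁ ∈ Γ, ∃ γ₂ ∈ Γ, γ₁ * γ₂ ≠ γ₂ * γ₁) :
    ∃ (M : Subgroup Γ) (_ : M.Normal) (φ : M → ℝ), (∀ a b, φ (a * b) = φ a + φ b) ∧
      (∀ a b : M, ∀ x : ℝ, (a : Equiv.Perm ℝ) x < (b : Equiv.Perm ℝ) x ↔ φ a < φ b) ∧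
      DenseRange φ ∧
      ∀ γ : Γ, ∃ l : ℝ, 0 < l ∧ ∀ m : M, φ (MulAut.conjNormal γ m) = l * φ m := by
  have hex := exists_ne_one_fixed horient hnonab
  obtain ⟨χ, hχ, hχfix⟩ := exists_hom_ne_zero_of_fixed horient hfix
    (exists_apply_ne horient hfix hnonab) hex
  let χ' : Γ →* Multiplicative ℝ :=
    MonoidHom.mk' (fun g => Multiplicative.ofAdd (χ g)) fun a b => by rw [hχ]; rfl
  let M : Subgroup Γ := χ'.ker
  have hM : ∀ g : Γ, g ∈ M ↔ χ g = 0 := fun g => by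
    simp [M, χ', MonoidHom.mem_ker]
  have hfree : ∀ m : M, m ≠ 1 → ∀ x : ℝ, (m : Equiv.Perm ℝ) x ≠ x := fun m hm x hx =>
    hχfix m (fun h => hm (Subtype.ext h)) x hx ((hM m).1 m.2)
  obtain ⟨φ, hφ, hlt⟩ := exists_translation_hom_of_free (Γ.subtype.comp M.subtype)
    (fun m => horient m m.1.2) isUpperSet_univ Set.univ_nonempty (fun _ _ _ => trivial)
    fun m hm x _ => hfree m hm x
  have hlt : ∀ a b : M, ∀ x : ℝ, (a : Equiv.Perm ℝ) x < (b : Equiv.Perm ℝ) x ↔ φ a < φ b :=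
    fun a b x => hlt a b x trivial
  have hone : φ 1 = 0 := by
    have := hφ 1 1
    rw [mul_one] at this
    linarith
  have hinv : ∀ m, φ m⁻¹ = -φ m := fun m => by
    have := hφ m m⁻¹
    rw [mul_inv_cancel, hone] at this
    linarith
  have hinj : Function.Injective φ := fun a b hab => by
    refine Subtype.ext (Subtype.ext (Equiv.ext fun x => ?_))
    exact le_antisymm (not_lt.1 fun h => ((hlt _ _ x).1 h).ne' hab)
      (not_lt.1 fun h => ((hlt _ _ x).1 h).ne hab)
  obtain ⟨e, he⟩ : ∃ e : M, 0 < φ e := by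
    obtain ⟨a, ha, b, hb, hab⟩ := hnonab
    let α : Γ := ⟨a, ha⟩
    let β : Γ := ⟨b, hb⟩
    have hχone : χ 1 = 0 := by
      have := hχ 1 1
      rw [mul_one] at this
      linarith
    have hc : α * β * (β * α)⁻¹ ∈ M := by
      rw [hM]
      have h₁ := hχ (β * α) (β * α)⁻¹
      rw [mul_inv_cancel, hχone] at h₁
      have h₂ := hχ (α * β) (β * α)⁻¹
      rw [hχ α β, add_comm (χ α), ← hχ β α] at h₂
      linarith
    have hc0 : φ ⟨_, hc⟩ ≠ 0 := fun h0 => by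
      rw [← hone] at h0
      have := congrArg Subtype.val (hinj h0)
      simp only [OneMemClass.coe_one, mul_inv_eq_one] at this
      exact hab (congrArg Subtype.val this)
    rcases lt_or_gt_of_ne hc0 with h | h
    · exact ⟨⟨_, hc⟩⁻¹, by rw [hinv]; linarith⟩
    · exact ⟨⟨_, hc⟩, h⟩
  have hconj_apply : ∀ (γ : Γ) (m : M) (x : ℝ),
      ((MulAut.conjNormal γ m : M) : Equiv.Perm ℝ) x =
        (γ : Equiv.Perm ℝ) ((m : Equiv.Perm ℝ) ((γ : Equiv.Perm ℝ)⁻¹ x)) := fun γ m x => by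
    rw [MulAut.conjNormal_apply]
    simp
  have hconj_lt : ∀ (γ : Γ) (a b : M), φ a < φ b →
      φ (MulAut.conjNormal γ a) < φ (MulAut.conjNormal γ b) := fun γ a b hab => by
    rw [← hlt _ _ 0, hconj_apply, hconj_apply]
    exact horient γ γ.2 ((hlt a b _).2 hab)
  have hscale : ∀ γ : Γ, ∃ l : ℝ, 0 < l ∧ ∀ m : M, φ (MulAut.conjNormal γ m) = l * φ m := by
    intro γ
    refine ⟨φ (MulAut.conjNormal γ e) / φ e, div_pos ?_ he, fun m => ?_⟩
    · have := hconj_lt γ 1 e (by rwa [hone])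
      rwa [map_one, hone] at this
    · have := hom_eq_mul_of_lt_imp_le hφ (ψ := fun m => φ (MulAut.conjNormal γ m))
        (fun a b => by rw [map_mul, hφ]) (fun a b hab => (hconj_lt γ a b hab).le) he m
      field_simp
      linarith
  obtain ⟨k, l, hl0, hl1, hl⟩ : ∃ (k : Γ) (l : ℝ), 0 < l ∧ l < 1 ∧
      ∀ m : M, φ (MulAut.conjNormal k m) = l * φ m := by
    obtain ⟨k, hkΓ, hk1, p, hp⟩ := hex
    obtain ⟨l, hl0, hl⟩ := hscale ⟨k, hkΓ⟩
    rcases lt_trichotomy l 1 with h | rfl | h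
    · exact ⟨_, l, hl0, h, hl⟩
    · exfalso
      have h₁ := hinj ((hl e).trans (one_mul _))
      have h₂ := hconj_apply ⟨k, hkΓ⟩ e p
      rw [h₁] at h₂
      have h₃ : k⁻¹ p = p := by rw [Equiv.Perm.inv_eq_iff_eq, hp]
      simp only [h₃] at h₂
      have h₄ := hfix k hkΓ hk1 _ _ h₂.symm hp
      refine hfree e ?_ p h₄
      rintro rfl
      exact he.ne' hone
    · refine ⟨⟨k, hkΓ⟩⁻¹, l⁻¹, inv_pos.2 hl0, inv_lt_one_of_one_lt₀ h, fun m => ?_⟩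
      have := hl (MulAut.conjNormal (⟨k, hkΓ⟩ : Γ)⁻¹ m)
      rw [← MulAut.mul_apply, ← map_mul, mul_inv_cancel, map_one, MulAut.one_apply] at this
      field_simp
      linarith
  refine ⟨M, inferInstance, φ, hφ, hlt, ?_, hscale⟩
  let R : AddSubgroup ℝ :=
    { carrier := Set.range φ
      add_mem' := by
        rintro _ _ ⟨a, rfl⟩ ⟨b, rfl⟩
        exact ⟨a * b, hφ a b⟩
      zero_mem' := ⟨1, hone⟩
      neg_mem' := by
        rintro _ ⟨a, rfl⟩
        exact ⟨a⁻¹, hinv a⟩ }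
  have hpow : ∀ n : ℕ, l ^ n * φ e ∈ R := fun n => by
    induction n with
    | zero => exact ⟨e, by simp⟩
    | succ n ih =>
      obtain ⟨m, hm⟩ := ih
      exact ⟨MulAut.conjNormal k m, by rw [hl, hm]; ring⟩
  refine R.dense_of_not_isolated_zero fun ε hε => ?_
  have ht : Tendsto (fun n : ℕ => l ^ n * φ e) atTop (𝓝 0) := by
    simpa using (tendsto_pow_atTop_nhds_zero_of_lt_one hl0.le hl1).mul_const (φ e)
  obtain ⟨n, hn⟩ := (ht.eventually_lt_const hε).exists
  exact ⟨_, hpow n, by positivity, hn⟩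

end Solodov

open Solodov in
/-- **Solodov's theorem** (semi-conjugacy part).  Let `Γ` be a non-abelian group of
orientation-preserving homeomorphisms of the real line (modelled as a subgroup of the
permutation group of `ℝ` all of whose elements are strictly increasing) such that every
non-identity element of `Γ` has at most one fixed point.  Then there are an injective
group homomorphism `ρ` from `Γ` into the orientation-preserving affine group of `ℝ`
(realized inside the permutations of `ℝ`, each value being a map `x ↦ a * x + b` with
`a > 0`) and a nondecreasing continuous surjective map `h : ℝ → ℝ` such that
`h (γ x) = ρ γ (h x)` for all `γ ∈ Γ` and `x ∈ ℝ`. -/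
theorem solodov_semiconjugacy
    (Γ : Subgroup (Equiv.Perm ℝ))
    (horient : ∀ γ ∈ Γ, StrictMono γ)
    (hfix : ∀ γ ∈ Γ, γ ≠ 1 → ∀ x y : ℝ, γ x = x → γ y = y → x = y)
    (hnonab : ∃ γ₁ ∈ Γ, ∃ γ₂ ∈ Γ, γ₁ * γ₂ ≠ γ₂ * γ₁) :
    ∃ ρ : Γ →* Equiv.Perm ℝ, ∃ h : ℝ → ℝ,
      Function.Injective ρ ∧
      (∀ γ : Γ, ∃ a b : ℝ, 0 < a ∧ ∀ x : ℝ, ρ γ x = a * x + b) ∧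
      Monotone h ∧ Continuous h ∧ Function.Surjective h ∧
      ∀ γ : Γ, ∀ x : ℝ, h ((γ : Equiv.Perm ℝ) x) = ρ γ (h x) := by
  obtain ⟨M, hMn, φ, hφ, hlt, hdense, hscale⟩ :=
    exists_normal_translation_subgroup horient hfix hnonab
  let act : M →* Equiv.Perm ℝ := Γ.subtype.comp M.subtype
  obtain ⟨h, h_mono, h_cont, h_surj, hequiv⟩ := exists_semiconj_translation act
    (fun m => horient m m.1.2) hφ hlt hdense
  choose l hl0 hl using hscale
  have hconj : ∀ (γ : Γ) (m : M) (x : ℝ), (γ : Equiv.Perm ℝ) (act m x) =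
      act (MulAut.conjNormal γ m) ((γ : Equiv.Perm ℝ) x) := fun γ m x => by
    simp [act, MulAut.conjNormal_apply]
  have haff : ∀ (γ : Γ) (x : ℝ), h ((γ : Equiv.Perm ℝ) x) =
      l γ * h x + (h ((γ : Equiv.Perm ℝ) 0) - l γ * h 0) := fun γ x =>
    affine_of_rescale act hdense h_mono hequiv (H := fun x => h ((γ : Equiv.Perm ℝ) x))
      (h_mono.comp (horient γ γ.2).monotone) (hl0 γ)
      (fun m x => by rw [hconj, hequiv, hl]) x
  let r : Γ → Equiv.Perm ℝ := fun γ =>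
    affinePerm (l γ) (h ((γ : Equiv.Perm ℝ) 0) - l γ * h 0) (hl0 γ)
  have hr : ∀ (γ : Γ) (x : ℝ), h ((γ : Equiv.Perm ℝ) x) = r γ (h x) := haff
  refine ⟨MonoidHom.mk' r fun γ δ => Equiv.ext fun y => ?_, h, ?_,
    fun γ => ⟨l γ, _, hl0 γ, fun x => rfl⟩, h_mono, h_cont, h_surj, hr⟩
  · obtain ⟨x, rfl⟩ := h_surj y
    rw [← hr, Equiv.Perm.mul_apply, ← hr δ, ← hr γ]
    rfl
  · have not_invariant : ∀ f ∈ Γ, (∀ x, h (f x) = h x) → ∀ N, ¬ ∀ x, N ≤ x → x < f x := by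
      intro f hf hfh N hN
      have hpow : ∀ n : ℕ, h ((f ^ n) N) = h N := fun n => by
        induction n with
        | zero => simp
        | succ n ih => rw [pow_succ', Equiv.Perm.mul_apply, hfh, ih]
      obtain ⟨x, hx⟩ := h_surj (h N + 1)
      obtain ⟨n, hn⟩ := ((tendsto_pow_apply_atTop (horient f hf) hN).eventually_ge_atTop x).exists
      have := h_mono hn
      rw [hpow, hx] at this
      linarith
    refine (injective_iff_map_eq_one _).2 fun γ hγ => ?_
    by_contra hne
    have hγh : ∀ x, h ((γ : Equiv.Perm ℝ) x) = h x := fun x => by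
      rw [hr, show r γ = 1 from hγ]
      rfl
    obtain ⟨N, hN | hN⟩ := exists_forall_ge_lt_apply horient hfix γ.2
      fun h' => hne (Subtype.ext h')
    · exact not_invariant γ γ.2 hγh N hN
    · refine not_invariant (γ : Equiv.Perm ℝ)⁻¹ (inv_mem γ.2) (fun x => ?_) N hN
      have := hγh ((γ : Equiv.Perm ℝ)⁻¹ x)
      simpa using this.symm
end

section
/- Let Γ be a group of orientation-preserving homeomorphisms of the real line ℝ such that every element of Γ other than the identity has at most one fixed point. Then Γ is a solvable group. -/
section OrderedGroup

variable {G : Type*} [Group G] [LinearOrder G] [MulLeftMono G] [MulRightMono G]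

theorem zpow_right_strictMono_of_one_lt {G : Type*} [Group G] [LinearOrder G] [MulLeftMono G]
    {h : G} (h1 : 1 < h) : StrictMono fun n : ℤ => h ^ n := by
  refine strictMono_int_of_lt_succ fun n => ?_
  simpa [zpow_add_one] using h1

theorem mul_pow_le_of_mul_le {g k : G} (hgk : k * g ≤ g * k) (n : ℕ) :
    k ^ n * g ^ n ≤ (g * k) ^ n ∧ (g * k) ^ n ≤ g ^ n * k ^ n := by
  have hk : ∀ n : ℕ, k ^ n * g ≤ g * k ^ n := by
    intro n
    induction n with
    | zero => simp
    | succ n ih =>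
      calc k ^ (n + 1) * g = k ^ n * (k * g) := by rw [pow_succ, mul_assoc]
        _ ≤ k ^ n * (g * k) := by gcongr
        _ = k ^ n * g * k := by rw [mul_assoc]
        _ ≤ g * k ^ n * k := by gcongr
        _ = g * k ^ (n + 1) := by rw [pow_succ, mul_assoc]
  induction n with
  | zero => simp
  | succ n ih =>
    constructor
    · calc k ^ (n + 1) * g ^ (n + 1) = k ^ (n + 1) * g * g ^ n := by rw [pow_succ' g, ← mul_assoc]
        _ ≤ g * k ^ (n + 1) * g ^ n := mul_le_mul' (hk _) le_rfl
        _ = g * k * (k ^ n * g ^ n) := by simp only [pow_succ' k, mul_assoc]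
        _ ≤ g * k * (g * k) ^ n := by gcongr; exact ih.1
        _ = (g * k) ^ (n + 1) := (pow_succ' _ _).symm
    · calc (g * k) ^ (n + 1) = (g * k) ^ n * (g * k) := pow_succ _ _
        _ ≤ g ^ n * k ^ n * (g * k) := by gcongr; exact ih.2
        _ = g ^ n * (k ^ n * g) * k := by simp only [mul_assoc]
        _ ≤ g ^ n * (g * k ^ n) * k := by gcongr g ^ n * ?_ * k; exact hk _
        _ = g ^ (n + 1) * k ^ (n + 1) := by simp only [pow_succ, mul_assoc]

theorem mul_pow_mem_uIcc (g k : G) (n : ℕ) :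
    (g * k) ^ n ∈ Set.uIcc (g ^ n * k ^ n) (k ^ n * g ^ n) := by
  rcases le_total (k * g) (g * k) with h | h
  · exact Set.mem_uIcc.2 (Or.inr (mul_pow_le_of_mul_le h n))
  · have := mul_pow_le_of_mul_le (G := Gᵒᵈ) (g := OrderDual.toDual g) (k := OrderDual.toDual k) h n
    exact Set.mem_uIcc.2 (Or.inl ⟨this.2, this.1⟩)

/-- In a bi-ordered group, an element `h > 1` whose powers are cofinal yields a homomorphism to
the reals whose kernel consists of elements that are infinitesimal with respect to `h`. -/
theorem exists_hom_real_of_cofinal {h : G} (h1 : 1 < h) (hc : ∀ g : G, ∃ n : ℕ, g ≤ h ^ n) :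
    ∃ φ : G →* Multiplicative ℝ, ∀ g, φ g = 1 → ∀ n : ℕ, g ^ n < h := by
  have hmono := zpow_right_strictMono_of_one_lt h1
  have hex : ∀ g : G, ∃ m : ℤ, h ^ m ≤ g ∧ ∀ j : ℤ, h ^ j ≤ g → j ≤ m := by
    intro g
    obtain ⟨a, ha⟩ := hc g
    obtain ⟨b, hb⟩ := hc g⁻¹
    refine Int.exists_greatest_of_bdd ⟨a, fun z hz => ?_⟩ ⟨-b, ?_⟩
    · exact hmono.le_iff_le.1 (hz.trans (by simpa using ha))
    · simpa using inv_le_of_inv_le' hb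
  choose m hm hmax using hex
  have hlt : ∀ g, g < h ^ (m g + 1) := fun g => by
    by_contra! hg
    have := hmax _ _ hg
    omega
  have hub : ∀ g (j : ℤ), g < h ^ j → m g < j := fun g j hj =>
    hmono.lt_iff_lt.1 ((hm g).trans_lt hj)
  have hadd : ∀ g k, m g + m k ≤ m (g * k) := fun g k =>
    hmax _ _ (by rw [zpow_add]; exact mul_le_mul' (hm g) (hm k))
  have hadd' : ∀ g k, m (g * k) ≤ m g + m k + 1 := fun g k => by
    have : g * k < h ^ ((m g + 1) + (m k + 1)) := by
      rw [zpow_add]; exact mul_lt_mul_of_lt_of_lt (hlt g) (hlt k)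
    have := hub _ _ this
    omega
  have hm_mono : ∀ {a b}, a ≤ b → m a ≤ m b := fun hab => hmax _ _ ((hm _).trans hab)
  have hquasi : ∀ g k (n : ℕ), |m ((g * k) ^ n) - (m (g ^ n) + m (k ^ n))| ≤ 1 := by
    intro g k n
    have a1 := hadd (g ^ n) (k ^ n)
    have a2 := hadd (k ^ n) (g ^ n)
    have a3 := hadd' (g ^ n) (k ^ n)
    have a4 := hadd' (k ^ n) (g ^ n)
    rw [abs_le]
    rcases Set.mem_uIcc.1 (mul_pow_mem_uIcc g k n) with ⟨l, r⟩ | ⟨l, r⟩ <;>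
    · have := hm_mono l
      have := hm_mono r
      constructor <;> omega
  have hsub : ∀ g, Subadditive fun n : ℕ => -(m (g ^ n) : ℝ) := fun g a b => by
    have : (m (g ^ a) : ℝ) + m (g ^ b) ≤ m (g ^ (a + b)) := by
      rw [pow_add]; exact_mod_cast hadd _ _
    linarith
  have hbdd : ∀ g, BddBelow (Set.range fun n : ℕ => -(m (g ^ n) : ℝ) / n) := by
    intro g
    refine ⟨-|(m g : ℝ) + 1|, ?_⟩
    rintro _ ⟨n, rfl⟩
    rcases Nat.eq_zero_or_pos n with rfl | hn
    · simp
    have h2 : m (g ^ n) ≤ (m g + 1) * n := by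
      have : h ^ m (g ^ n) ≤ h ^ ((m g + 1) * n) := (hm _).trans <| by
        rw [zpow_mul, zpow_natCast]
        exact pow_le_pow_left' (hlt g).le n
      exact hmono.le_iff_le.1 this
    have h3 : (m (g ^ n) : ℝ) ≤ (m g + 1) * n := by exact_mod_cast h2
    have hn' : (0 : ℝ) < n := by exact_mod_cast hn
    have : (m (g ^ n) : ℝ) / n ≤ m g + 1 := by rwa [div_le_iff₀ hn']
    have := le_abs_self ((m g : ℝ) + 1)
    simp only [neg_div]
    linarith
  have hlim : ∀ g, Filter.Tendsto (fun n : ℕ => (m (g ^ n) : ℝ) / n) Filter.atTop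
      (nhds (-(hsub g).lim)) := fun g => by
    simpa [neg_div] using ((hsub g).tendsto_lim (hbdd g)).neg
  have hhom : ∀ g k, -(hsub (g * k)).lim = -(hsub g).lim + -(hsub k).lim := by
    intro g k
    have h0 : Filter.Tendsto
        (fun n : ℕ => (m ((g * k) ^ n) : ℝ) / n - ((m (g ^ n) : ℝ) / n + (m (k ^ n) : ℝ) / n))
        Filter.atTop (nhds 0) := by
      refine squeeze_zero_norm (fun n => ?_) tendsto_one_div_atTop_nhds_zero_nat
      rw [← add_div, ← sub_div, Real.norm_eq_abs, abs_div, Nat.abs_cast]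
      gcongr
      exact_mod_cast hquasi g k n
    have := tendsto_nhds_unique h0 ((hlim (g * k)).sub ((hlim g).add (hlim k)))
    linarith
  refine ⟨MonoidHom.mk' (fun g => Multiplicative.ofAdd (-(hsub g).lim)) fun g k => ?_,
    fun g hg n => ?_⟩
  · rw [hhom]; rfl
  · have hg0 : -(hsub g).lim = 0 := hg
    by_contra! hn
    have hn0 : n ≠ 0 := by
      rintro rfl
      exact absurd h1 (by simpa using hn)
    have h2 : (1 : ℝ) ≤ m (g ^ n) := by exact_mod_cast hmax _ 1 (by simpa using hn)
    have h3 := (hsub g).lim_le_div (hbdd g) hn0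
    have hn' : (0 : ℝ) < n := by positivity
    have : 0 < (m (g ^ n) : ℝ) / n := by positivity
    rw [neg_div] at h3
    linarith

end OrderedGroup

theorem eventually_lt_iterate_of_forall_lt {α : Type*} [ConditionallyCompleteLinearOrder α]
    [TopologicalSpace α] [OrderTopology α] {f : α → α} (hf : Continuous f) {y : α}
    (hlt : ∀ t, y ≤ t → t < f t) (M : α) : ∀ᶠ n : ℕ in Filter.atTop, M < f^[n] y := by
  have hle : ∀ n, y ≤ f^[n] y := by
    intro n
    induction n with
    | zero => exact le_rfl
    | succ n ih =>
      rw [Function.iterate_succ_apply']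
      exact ih.trans (hlt _ ih).le
  have hmono : Monotone fun n => f^[n] y := monotone_nat_of_le_succ fun n => by
    rw [Function.iterate_succ_apply']
    exact (hlt _ (hle n)).le
  by_contra hcon
  have hM : ∀ n, f^[n] y ≤ M := fun n => by
    by_contra! hn
    exact hcon ((Filter.eventually_ge_atTop n).mono fun k hk => hn.trans_le (hmono hk))
  have hbdd : BddAbove (Set.range fun n => f^[n] y) := ⟨M, by rintro _ ⟨n, rfl⟩; exact hM n⟩
  have hfixed := isFixedPt_of_tendsto_iterate (tendsto_atTop_ciSup hmono hbdd) hf.continuousAt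
  exact (hlt _ (le_ciSup hbdd 0)).ne' hfixed

theorem forall_lt_of_forall_ne {f g : ℝ → ℝ} (hf : Continuous f) (hg : Continuous g) {y : ℝ}
    (hne : ∀ t, y ≤ t → f t ≠ g t) (hy : f y < g y) : ∀ t, y ≤ t → f t < g t := by
  intro t ht
  by_contra! hle
  obtain ⟨s, hs, he⟩ := isPreconnected_Icc.intermediate_value₂ (Set.left_mem_Icc.2 ht)
    (Set.right_mem_Icc.2 ht) hf.continuousOn hg.continuousOn hy.le hle
  exact hne s hs.1 he

section LineAction

open Filter

variable {G : Type*} [Group G] {ρ : G →* Equiv.Perm ℝ}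

theorem eq_of_apply_eq_apply
    (hfix : ∀ g, g ≠ 1 → ∀ x y : ℝ, ρ g x = x → ρ g y = y → x = y) {a b : G} (hab : a ≠ b)
    {s t : ℝ} (hs : ρ a s = ρ b s) (ht : ρ a t = ρ b t) : s = t := by
  refine hfix (a⁻¹ * b) (fun h => hab (inv_mul_eq_one.1 h)) s t ?_ ?_
  · rw [map_mul, map_inv, Equiv.Perm.mul_apply, ← hs, Equiv.Perm.inv_def, Equiv.symm_apply_apply]
  · rw [map_mul, map_inv, Equiv.Perm.mul_apply, ← ht, Equiv.Perm.inv_def, Equiv.symm_apply_apply]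

theorem continuous_of_strictMono (hmono : ∀ g, StrictMono (ρ g)) (g : G) : Continuous (ρ g) :=
  (hmono g).monotone.continuous_of_surjective (ρ g).surjective

theorem eventually_lt_or_gt (hmono : ∀ g, StrictMono (ρ g))
    (hfix : ∀ g, g ≠ 1 → ∀ x y : ℝ, ρ g x = x → ρ g y = y → x = y) {a b : G} (hab : a ≠ b) :
    (∀ᶠ x in atTop, ρ a x < ρ b x) ∨ ∀ᶠ x in atTop, ρ b x < ρ a x := by
  obtain ⟨y, hy⟩ : ∃ y, ∀ t, y ≤ t → ρ a t ≠ ρ b t := by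
    by_cases h : ∃ s, ρ a s = ρ b s
    · obtain ⟨s, hs⟩ := h
      refine ⟨s + 1, fun t ht he => ?_⟩
      have := eq_of_apply_eq_apply hfix hab hs he
      linarith
    · exact ⟨0, fun t _ he => h ⟨t, he⟩⟩
  have ca := continuous_of_strictMono hmono a
  have cb := continuous_of_strictMono hmono b
  rcases (hy y le_rfl).lt_or_gt with h | h
  · exact Or.inl ((eventually_ge_atTop y).mono (forall_lt_of_forall_ne ca cb hy h))
  · exact Or.inr ((eventually_ge_atTop y).mono
      (forall_lt_of_forall_ne cb ca (fun t ht => (hy t ht).symm) h))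

theorem tendsto_apply_atTop (hmono : ∀ g, StrictMono (ρ g)) (g : G) :
    Tendsto (ρ g) atTop atTop :=
  tendsto_atTop_atTop_of_monotone (hmono g).monotone fun b =>
    ⟨(ρ g).symm b, ((ρ g).apply_symm_apply b).ge⟩

/-- Comparing germs at `+∞` bi-orders a group acting on the line so that nontrivial elements have
at most one fixed point. -/
theorem exists_linearOrder_eventually (hmono : ∀ g, StrictMono (ρ g))
    (hfix : ∀ g, g ≠ 1 → ∀ x y : ℝ, ρ g x = x → ρ g y = y → x = y) :
    ∃ _ : LinearOrder G, MulLeftMono G ∧ MulRightMono G ∧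
      ∀ a b : G, a ≤ b ↔ ∀ᶠ x in atTop, ρ a x ≤ ρ b x := by
  classical
  let o : LinearOrder G :=
    { le := fun a b => ∀ᶠ x in atTop, ρ a x ≤ ρ b x
      le_refl := fun a => Eventually.of_forall fun x => le_rfl
      le_trans := fun a b c hab hbc => by
        filter_upwards [hab, hbc] with x h1 h2 using h1.trans h2
      le_antisymm := fun a b hab hba => by
        by_contra hne
        rcases eventually_lt_or_gt hmono hfix hne with h | h
        · obtain ⟨x, h1, h2⟩ := (h.and hba).exists
          exact h1.not_ge h2
        · obtain ⟨x, h1, h2⟩ := (h.and hab).exists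
          exact h1.not_ge h2
      le_total := fun a b => by
        rcases eq_or_ne a b with rfl | hne
        · exact Or.inl (Eventually.of_forall fun x => le_rfl)
        · exact (eventually_lt_or_gt hmono hfix hne).imp (fun h => h.mono fun _ => le_of_lt)
            fun h => h.mono fun _ => le_of_lt
      toDecidableLE := Classical.decRel _ }
  refine ⟨o, ⟨fun c a b hab => ?_⟩, ⟨fun c a b hab => ?_⟩, fun a b => Iff.rfl⟩
  · have hab : ∀ᶠ x in atTop, ρ a x ≤ ρ b x := hab
    change ∀ᶠ x in atTop, ρ (c * a) x ≤ ρ (c * b) x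
    filter_upwards [hab] with x hx
    simpa only [map_mul, Equiv.Perm.mul_apply] using (hmono c).monotone hx
  · have hab : ∀ᶠ x in atTop, ρ a x ≤ ρ b x := hab
    change ∀ᶠ x in atTop, ρ (a * c) x ≤ ρ (b * c) x
    filter_upwards [(tendsto_apply_atTop hmono c).eventually hab] with x hx
    simpa only [map_mul, Equiv.Perm.mul_apply] using hx

theorem exists_hom_real_of_eventually_cofinal (hmono : ∀ g, StrictMono (ρ g))
    (hfix : ∀ g, g ≠ 1 → ∀ x y : ℝ, ρ g x = x → ρ g y = y → x = y) {h : G}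
    (h1 : ∀ᶠ x in atTop, x < ρ h x)
    (hc : ∀ g, ∃ n : ℕ, ∀ᶠ x in atTop, ρ g x ≤ ρ (h ^ n) x) :
    ∃ φ : G →* Multiplicative ℝ, ∀ g, φ g = 1 →
      ∀ n : ℕ, ¬ ∀ᶠ x in atTop, ρ h x ≤ ρ (g ^ n) x := by
  obtain ⟨_, _, _, hle⟩ := exists_linearOrder_eventually hmono hfix
  have h1' : 1 < h := by
    rw [← not_le, hle]
    intro h2
    obtain ⟨x, hx1, hx2⟩ := (h1.and h2).exists
    exact hx1.not_ge (by simpa using hx2)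
  obtain ⟨φ, hφ⟩ := exists_hom_real_of_cofinal h1' fun g => (hc g).imp fun n => (hle _ _).2
  exact ⟨φ, fun g hg n h2 => (hφ g hg n).not_ge ((hle _ _).2 h2)⟩

theorem forall_lt_apply_and_apply_lt (hmono : ∀ g, StrictMono (ρ g))
    (hfix : ∀ g, g ≠ 1 → ∀ x y : ℝ, ρ g x = x → ρ g y = y → x = y) {h : G} {x y : ℝ}
    (hxy : x < y) (hx : ρ h x < x) (hy : y < ρ h y) :
    (∀ t, y ≤ t → t < ρ h t) ∧ ∀ t, t ≤ x → ρ h t < t := by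
  have hcont := continuous_of_strictMono hmono
  have h1 : h ≠ 1 := by
    rintro rfl
    simp at hx
  obtain ⟨z, hz, hze⟩ := isPreconnected_Icc.intermediate_value₂ (Set.left_mem_Icc.2 hxy.le)
    (Set.right_mem_Icc.2 hxy.le) (hcont h).continuousOn continuousOn_id hx.le hy.le
  have hzx : x < z := hz.1.lt_of_ne (by rintro rfl; exact hx.ne hze)
  have hzy : z < y := hz.2.lt_of_ne (by rintro rfl; exact hy.ne' hze)
  refine ⟨forall_lt_of_forall_ne continuous_id (hcont h)
    (fun t ht he => (hzy.trans_le ht).ne (hfix h h1 z t hze he.symm)) hy, fun t ht => ?_⟩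
  by_contra! hle
  obtain ⟨s, hs, hse⟩ := isPreconnected_Icc.intermediate_value₂ (Set.right_mem_Icc.2 ht)
    (Set.left_mem_Icc.2 ht) (hcont h).continuousOn continuousOn_id hx.le hle
  exact (hs.2.trans_lt hzx).ne (hfix h h1 s z hse hze)

/-- If `h` moves some point to the left and some larger point to the right, then its powers are
cofinal for the comparison of germs at `+∞`. -/
theorem eventually_lt_pow_of_expanding (hmono : ∀ g, StrictMono (ρ g))
    (hfix : ∀ g, g ≠ 1 → ∀ x y : ℝ, ρ g x = x → ρ g y = y → x = y) {h : G} {x y : ℝ}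
    (hxy : x < y) (hx : ρ h x < x) (hy : y < ρ h y) (g : G) :
    ∃ n : ℕ, ∀ᶠ t in atTop, ρ g t < ρ (h ^ n) t := by
  have hcont := continuous_of_strictMono hmono
  obtain ⟨hright, hleft⟩ := forall_lt_apply_and_apply_lt hmono hfix hxy hx hy
  obtain ⟨n, hy', hx'⟩ := ((eventually_lt_iterate_of_forall_lt (hcont h) hright (ρ g y)).and
    (eventually_lt_iterate_of_forall_lt (α := ℝᵒᵈ) (f := ρ h) (hcont h) (y := x) hleft
      (ρ g x))).exists
  replace hx' : (ρ h)^[n] x < ρ g x := hx'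
  rw [Equiv.Perm.iterate_eq_pow, ← map_pow] at hx' hy'
  have hne : g ≠ h ^ n := fun he => by
    rw [← he] at hx'
    exact lt_irrefl _ hx'
  obtain ⟨s, hs, hse⟩ := isPreconnected_Icc.intermediate_value₂ (Set.right_mem_Icc.2 hxy.le)
    (Set.left_mem_Icc.2 hxy.le) (hcont g).continuousOn (hcont _).continuousOn hy'.le hx'.le
  have hsy : s < y := hs.2.lt_of_ne (by rintro rfl; exact hy'.ne hse)
  exact ⟨n, (eventually_ge_atTop y).mono (forall_lt_of_forall_ne (hcont _) (hcont _)
    (fun t ht he => (hsy.trans_le ht).ne (eq_of_apply_eq_apply hfix hne hse he)) hy')⟩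

theorem le_of_lt_of_forall_not_expanding (hmono : ∀ g, StrictMono (ρ g))
    (hexp : ∀ (g : G) (x y : ℝ), x < y → ρ g x < x → ρ g y ≤ y) {a b : G} {y : ℝ}
    (hy : ρ a y < ρ b y) (x : ℝ) : ρ a x ≤ ρ b x := by
  have key : ∀ (a b : G) (x y : ℝ), x < y → ρ a x < ρ b x → ρ a y ≤ ρ b y := by
    intro a b x y hxy hx
    have hinv : ∀ t, ρ b (ρ (b⁻¹ * a) t) = ρ a t := fun t => by
      rw [← Equiv.Perm.mul_apply, ← map_mul, mul_inv_cancel_left]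
    have := hexp (b⁻¹ * a) x y hxy (by rwa [← (hmono b).lt_iff_lt, hinv])
    rwa [← (hmono b).le_iff_le, hinv] at this
  by_contra! hx
  rcases lt_trichotomy x y with h | rfl | h
  · exact (key b a x y h hx).not_gt hy
  · exact lt_asymm hx hy
  · exact (key a b y x h hy).not_gt hx

theorem isSolvable_of_forall_not_expanding (hmono : ∀ g, StrictMono (ρ g))
    (hfix : ∀ g, g ≠ 1 → ∀ x y : ℝ, ρ g x = x → ρ g y = y → x = y)
    (hexp : ∀ (g : G) (x y : ℝ), x < y → ρ g x < x → ρ g y ≤ y) : Group.IsSolvable G := by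
  have hcof : ∀ f : G, (∀ᶠ x in atTop, x < ρ f x) → ∀ g, ∃ n : ℕ, ∀ x, ρ g x ≤ ρ (f ^ n) x := by
    intro f hf g
    obtain ⟨y, hy⟩ := eventually_atTop.1 hf
    obtain ⟨n, hn⟩ := (eventually_lt_iterate_of_forall_lt (continuous_of_strictMono hmono f) hy
      (ρ g y)).exists
    rw [Equiv.Perm.iterate_eq_pow, ← map_pow] at hn
    exact ⟨n, le_of_lt_of_forall_not_expanding hmono hexp hn⟩
  have hpos : ∀ f : G, f ≠ 1 → (∀ᶠ x in atTop, x < ρ f x) ∨ ∀ᶠ x in atTop, x < ρ f⁻¹ x := by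
    intro f hf
    refine (eventually_lt_or_gt hmono hfix hf.symm).imp (by simp) fun h => h.mono fun x hx => ?_
    rw [← (hmono f).lt_iff_lt, map_inv, Equiv.Perm.inv_def, Equiv.apply_symm_apply]
    simpa using hx
  by_cases htriv : ∃ f : G, ∀ᶠ x in atTop, x < ρ f x
  · obtain ⟨f, hf⟩ := htriv
    obtain ⟨φ, hφ⟩ := exists_hom_real_of_eventually_cofinal hmono hfix hf fun g =>
      (hcof f hf g).imp fun n => Eventually.of_forall
    refine Group.isSolvable_of_isSolvable_injective (f := φ)
      ((injective_iff_map_eq_one φ).2 fun g hg => ?_)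
    by_contra hne
    rcases hpos g hne with h | h
    · obtain ⟨n, hn⟩ := hcof g h f
      exact hφ g hg n (Eventually.of_forall hn)
    · obtain ⟨n, hn⟩ := hcof g⁻¹ h f
      exact hφ g⁻¹ (by rw [map_inv, hg, inv_one]) n (Eventually.of_forall hn)
  · have : Subsingleton G := subsingleton_of_forall_eq 1 fun f => by
      by_contra hne
      rcases hpos f hne with h | h
      · exact htriv ⟨f, h⟩
      · exact htriv ⟨f⁻¹, h⟩
    infer_instance

theorem isSolvable_of_apply_eq_imp_eq (hmono : ∀ g, StrictMono (ρ g))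
    (hfix : ∀ g, g ≠ 1 → ∀ x y : ℝ, ρ g x = x → ρ g y = y → x = y) : Group.IsSolvable G := by
  by_cases hexp : ∀ (g : G) (x y : ℝ), x < y → ρ g x < x → ρ g y ≤ y
  · exact isSolvable_of_forall_not_expanding hmono hfix hexp
  push Not at hexp
  obtain ⟨h, x, y, hxy, hx, hy⟩ := hexp
  have hcof := fun g => (eventually_lt_pow_of_expanding hmono hfix hxy hx hy g).imp
    fun n hn => hn.mono fun _ => le_of_lt
  have h1 : ∀ᶠ t in atTop, t < ρ h t := (eventually_ge_atTop y).mono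
    (forall_lt_apply_and_apply_lt hmono hfix hxy hx hy).1
  obtain ⟨φ, hφ⟩ := exists_hom_real_of_eventually_cofinal hmono hfix h1 hcof
  have : Group.IsSolvable φ.ker := by
    refine isSolvable_of_forall_not_expanding (ρ := ρ.comp φ.ker.subtype) (fun g => hmono g)
      (fun g hg => hfix g fun he => hg (Subtype.ext he)) fun g x y hxy hx => ?_
    by_contra! hy
    obtain ⟨n, hn⟩ := eventually_lt_pow_of_expanding hmono hfix hxy hx hy h
    exact hφ g g.2 n (hn.mono fun _ => le_of_lt)
  exact Group.isSolvable_of_ker_le_range φ.ker.subtype φ φ.ker.range_subtype.ge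

end LineAction

/-- Let `Γ` be a group of orientation-preserving homeomorphisms of the real line
(modelled as a subgroup of the permutation group of `ℝ` all of whose elements are
strictly increasing; a strictly increasing bijection of `ℝ` is exactly an
orientation-preserving homeomorphism) such that every non-identity element of `Γ`
has at most one fixed point.  Then `Γ` is solvable. -/
theorem solvable_of_at_most_one_fixed_point
    (Γ : Subgroup (Equiv.Perm ℝ))
    (horient : ∀ γ ∈ Γ, StrictMono γ)
    (hfix : ∀ γ ∈ Γ, γ ≠ 1 → ∀ x y : ℝ, γ x = x → γ y = y → x = y) :
    IsSolvable Γ :=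
  isSolvable_of_apply_eq_imp_eq (ρ := Γ.subtype) (fun g => horient g g.2)
    fun g hg => hfix g g.2 fun he => hg (Subtype.ext he)
end

section
/- Let A be a dense additive subgroup of ℝ, let τ : A → ℝ be any function, and let f : ℝ → ℝ be a strictly increasing function satisfying f(t + a) = f(t) + τ(a) for every t ∈ ℝ and every a ∈ A. Then there exists a constant c > 0 such that f(t) = f(0) + c·t for all t ∈ ℝ; in particular τ(a) = c·a for all a ∈ A. -/
/-- A real function with a point of continuity that is equivariant under a dense subgroup of
translations is continuous. -/
theorem continuous_of_continuousAt_of_dense_translations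
    {A : AddSubgroup ℝ} (hA : Dense (A : Set ℝ)) {τ : A → ℝ} {f : ℝ → ℝ}
    (heq : ∀ t : ℝ, ∀ a : A, f (t + a) = f t + τ a) {x : ℝ} (hx : ContinuousAt f x) :
    Continuous f := by
  refine continuous_iff_continuousAt.2 fun t => Metric.continuousAt_iff'.2 fun ε hε => ?_
  obtain ⟨δ, hδ, h⟩ := Metric.continuousAt_iff.1 hx (ε / 2) (half_pos hε)
  obtain ⟨a, ha, hat⟩ := hA.exists_dist_lt (x - t) hδ
  have hta : t + a ∈ Metric.ball x δ := by
    rw [Metric.mem_ball, dist_comm]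
    rw [Real.dist_eq] at hat ⊢
    rwa [← sub_sub]
  have hcont : ContinuousAt (fun y => y + a) t := by fun_prop
  filter_upwards [hcont.eventually (Metric.isOpen_ball.mem_nhds hta)] with y hy
  have hsub : dist (f y) (f t) = dist (f (y + a)) (f (t + a)) := by
    rw [heq y ⟨a, ha⟩, heq t ⟨a, ha⟩, dist_add_right]
  rw [hsub, ← add_halves ε]
  exact (dist_triangle_right _ _ (f x)).trans_lt (add_lt_add (h hy) (h hta))

/-- A continuous real function that is equivariant under a dense subgroup of translations is
additive up to a constant. -/
theorem map_add_of_continuous_of_dense_translations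
    {A : AddSubgroup ℝ} (hA : Dense (A : Set ℝ)) {τ : A → ℝ} {f : ℝ → ℝ}
    (heq : ∀ t : ℝ, ∀ a : A, f (t + a) = f t + τ a) (hf : Continuous f) (t s : ℝ) :
    f (t + s) - f t = f s - f 0 := by
  have h : (fun s => f (t + s) - f t) = fun s => f s - f 0 := by
    refine Continuous.ext_on hA (by fun_prop) (by fun_prop) fun a ha => ?_
    have h0 := heq 0 ⟨a, ha⟩
    have ht := heq t ⟨a, ha⟩
    simp only [zero_add] at h0 ht ⊢
    linarith
  exact congrFun h s

/-- Let `A` be a dense additive subgroup of `ℝ`, `τ : A → ℝ` any function and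
`f : ℝ → ℝ` a strictly increasing function satisfying `f (t + a) = f t + τ a` for all
`t ∈ ℝ` and `a ∈ A`.  Then there is a constant `c > 0` with `f t = f 0 + c * t` for
all `t ∈ ℝ`; in particular `τ a = c * a` for all `a ∈ A`. -/
theorem strictMono_equivariant_under_dense_translations_is_affine
    (A : AddSubgroup ℝ) (hA : Dense (A : Set ℝ))
    (τ : A → ℝ) (f : ℝ → ℝ) (hf : StrictMono f)
    (heq : ∀ t : ℝ, ∀ a : A, f (t + a) = f t + τ a) :
    ∃ c : ℝ, 0 < c ∧ (∀ t : ℝ, f t = f 0 + c * t) ∧ ∀ a : A, τ a = c * (a : ℝ) := by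
  obtain ⟨x, hx⟩ : ∃ x, ContinuousAt f x := by
    obtain ⟨x, hx⟩ := (hf.monotone.countable_not_continuousAt.dense_compl ℝ).nonempty
    exact ⟨x, not_not.1 hx⟩
  have hcont := continuous_of_continuousAt_of_dense_translations hA heq hx
  let g : ℝ →+ ℝ := AddMonoidHom.mk' (fun t => f t - f 0) fun t s => by
    have := map_add_of_continuous_of_dense_translations hA heq hcont t s
    linarith
  have hg : Continuous g := hcont.sub continuous_const
  have hlin : ∀ t, f t = f 0 + (f 1 - f 0) * t := fun t => by
    have h : f t - f 0 = t * (f 1 - f 0) := by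
      simpa [g] using map_real_smul g hg t 1
    linarith
  refine ⟨f 1 - f 0, sub_pos.2 (hf one_pos), hlin, fun a => ?_⟩
  have h0 := heq 0 a
  rw [zero_add] at h0
  linarith [hlin a]
end

section
/- Let Λ be a dense subgroup of the multiplicative group of positive real numbers, let μ : Λ → (0, ∞) be any function, and let d : (0, ∞) → (0, ∞) be a strictly increasing function satisfying d(λ·t) = μ(λ)·d(t) for every λ ∈ Λ and every t > 0. Then there exist constants c > 0 and α > 0 such that d(t) = c·t^α for all t > 0, and μ(λ) = λ^α for all λ ∈ Λ. -/
/-- A monotone additive map from a subgroup of `ℝ` to `ℝ` is proportional to the inclusion. -/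
lemma Monotone.addMonoidHom_mul_eq_mul {A : AddSubgroup ℝ} {φ : A →+ ℝ} (hφ : Monotone φ)
    {b : A} (hb : 0 < (b : ℝ)) (a : A) : φ a * b = φ b * a := by
  have bound (x : A) : |φ x * b - φ b * x| ≤ φ b * b := by
    have hm := Int.floor_le ((x : ℝ) / b)
    have hm' := Int.lt_floor_add_one ((x : ℝ) / b)
    set m := ⌊(x : ℝ) / b⌋
    rw [le_div_iff₀ hb] at hm
    rw [div_lt_iff₀ hb] at hm'
    have h₁ : m • b ≤ x := by
      rw [← Subtype.coe_le_coe]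
      simpa using hm
    have h₂ : x ≤ (m + 1) • b := by
      rw [← Subtype.coe_le_coe]
      simpa using hm'.le
    have h₃ := hφ h₁
    have h₄ := hφ h₂
    rw [map_zsmul, zsmul_eq_mul] at h₃ h₄
    push_cast at h₄
    have hφb : 0 ≤ φ b := by
      simpa using hφ (show (0 : A) ≤ b from hb.le)
    rw [abs_le]
    constructor <;> nlinarith
  by_contra h
  obtain ⟨n, hn⟩ := exists_nat_gt (φ b * b / |φ a * b - φ b * a|)
  rw [div_lt_iff₀ (abs_pos.2 (sub_ne_zero.2 h))] at hn
  refine (bound (n • a)).not_gt (hn.trans_eq ?_)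
  rw [map_nsmul, ← Nat.abs_cast n, ← abs_mul]
  congr 1
  simp only [nsmul_eq_mul, AddSubgroup.coe_nsmul]
  ring

/-- A strictly monotone function on `ℝ` that is equivariant under a dense group of translations
is affine with positive slope. -/
lemma StrictMono.exists_eq_add_mul_of_equivariant {A : AddSubgroup ℝ} (hA : Dense (A : Set ℝ))
    {f g : ℝ → ℝ} (hf : StrictMono f) (h : ∀ a ∈ A, ∀ x, f (a + x) = g a + f x) :
    ∃ α, 0 < α ∧ ∀ x, f x = f 0 + α * x := by
  have hg (a : ℝ) (ha : a ∈ A) : g a = f a - f 0 := by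
    have := h a ha 0
    rw [add_zero] at this
    linarith
  let φ : A →+ ℝ := AddMonoidHom.mk' (fun a => f a - f 0) fun a b => by
    have := h a a.2 b
    rw [hg a a.2] at this
    push_cast
    linarith
  have hφ : Monotone φ := fun a b hab => sub_le_sub_right (hf.monotone hab) _
  obtain ⟨b, hbA, hb, -⟩ := hA.exists_between (zero_lt_one' ℝ)
  have hα : 0 < (f b - f 0) / b := div_pos (sub_pos.2 (hf hb)) hb
  set α := (f b - f 0) / b with hα_def
  have key (a : ℝ) (ha : a ∈ A) : f a = f 0 + α * a := by
    have := hφ.addMonoidHom_mul_eq_mul (b := ⟨b, hbA⟩) hb ⟨a, ha⟩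
    change (f a - f 0) * b = (f b - f 0) * a at this
    rw [hα_def]
    field_simp
    linarith
  refine ⟨α, hα, fun x => le_antisymm ?_ ?_⟩
  · by_contra! hx
    have hlt : x < (f x - f 0) / α := by
      rw [lt_div_iff₀ hα]
      linarith
    obtain ⟨a, ha, hxa, hax⟩ := hA.exists_between hlt
    rw [lt_div_iff₀ hα] at hax
    linarith [hf hxa, key a ha]
  · by_contra! hx
    have hlt : (f x - f 0) / α < x := by
      rw [div_lt_iff₀ hα]
      linarith
    obtain ⟨a, ha, hxa, hax⟩ := hA.exists_between hlt
    rw [div_lt_iff₀ hα] at hxa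
    linarith [hf hax, key a ha]

/-- Let `Λ` be a dense subgroup of the multiplicative group of positive real numbers
(modelled as a set of positive reals containing `1`, closed under multiplication and
inverses, and dense in `(0, ∞)`), let `μ` be any function assigning a positive value to
each element of `Λ`, and let `d` be a positive-valued function on `(0, ∞)`, strictly
increasing on `(0, ∞)`, satisfying `d (λ * t) = μ λ * d t` for all `λ ∈ Λ` and `t > 0`.
Then there are constants `c > 0` and `α > 0` with `d t = c * t ^ α` for all `t > 0`
and `μ λ = λ ^ α` for all `λ ∈ Λ`. -/
theorem power_form_of_equivariant_under_dense_multiplications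
    (Λ : Set ℝ)
    (hΛpos : ∀ l ∈ Λ, (0 : ℝ) < l)
    (hone : (1 : ℝ) ∈ Λ)
    (hmul : ∀ l ∈ Λ, ∀ m ∈ Λ, l * m ∈ Λ)
    (hinv : ∀ l ∈ Λ, l⁻¹ ∈ Λ)
    (hdense : ∀ x : ℝ, 0 < x → x ∈ closure Λ)
    (μ : ℝ → ℝ) (hμpos : ∀ l ∈ Λ, 0 < μ l)
    (d : ℝ → ℝ) (hdpos : ∀ t : ℝ, 0 < t → 0 < d t)
    (hdmono : StrictMonoOn d (Set.Ioi (0 : ℝ)))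
    (heq : ∀ l ∈ Λ, ∀ t : ℝ, 0 < t → d (l * t) = μ l * d t) :
    ∃ c α : ℝ, 0 < c ∧ 0 < α ∧
      (∀ t : ℝ, 0 < t → d t = c * t ^ α) ∧ ∀ l ∈ Λ, μ l = l ^ α := by
  let A : AddSubgroup ℝ :=
    { carrier := {x | Real.exp x ∈ Λ}
      zero_mem' := by simpa using hone
      add_mem' := fun {x y} hx hy => by simpa [Real.exp_add] using hmul _ hx _ hy
      neg_mem' := fun {x} hx => by simpa [Real.exp_neg] using hinv _ hx }
  have hA : Dense (A : Set ℝ) := by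
    refine dense_of_exists_between fun x y hxy => ?_
    obtain ⟨z, hz⟩ := exists_between (Real.exp_lt_exp.2 hxy)
    obtain ⟨l, hl, hlΛ⟩ := mem_closure_iff.1 (hdense z ((Real.exp_pos x).trans hz.1)) _
      isOpen_Ioo hz
    have hl₀ := hΛpos l hlΛ
    refine ⟨Real.log l, ?_, (Real.lt_log_iff_exp_lt hl₀).2 hl.1, (Real.log_lt_iff_lt_exp hl₀).2 hl.2⟩
    change Real.exp (Real.log l) ∈ Λ
    rwa [Real.exp_log hl₀]
  have hf : StrictMono fun x => Real.log (d (Real.exp x)) := fun x y hxy =>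
    Real.log_lt_log (hdpos _ (Real.exp_pos x))
      (hdmono (Real.exp_pos x) (Real.exp_pos y) (Real.exp_lt_exp.2 hxy))
  obtain ⟨α, hα, hd⟩ := hf.exists_eq_add_mul_of_equivariant hA
    (g := fun a => Real.log (μ (Real.exp a))) fun a ha x => by
      rw [Real.exp_add, heq _ ha _ (Real.exp_pos x),
        Real.log_mul (hμpos _ ha).ne' (hdpos _ (Real.exp_pos x)).ne']
  have hd₁ : 0 < d 1 := hdpos 1 one_pos
  have hpow (t : ℝ) (ht : 0 < t) : d t = d 1 * t ^ α := by
    have := hd (Real.log t)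
    rw [Real.exp_log ht, Real.exp_zero] at this
    rw [← Real.exp_log (hdpos t ht), this, Real.exp_add, Real.exp_log hd₁,
      Real.rpow_def_of_pos ht, mul_comm α]
  refine ⟨d 1, α, hd₁, hα, hpow, fun l hl => ?_⟩
  have := heq l hl 1 one_pos
  rw [mul_one, hpow l (hΛpos l hl), mul_comm] at this
  exact (mul_right_cancel₀ hd₁.ne' this).symm
end

section
/- Let H be a group and let ρᶜ, ρˢ : H → (0, ∞) be group homomorphisms into the multiplicative group of positive real numbers such that the image ρᶜ(H) is dense in (0, ∞). Let d : ℝ → ℝ be a strictly increasing function with d(0) = 0 satisfying d(ρᶜ(h)·t) = ρˢ(h)·d(t) for every h ∈ H and every t ∈ ℝ. Then there exist constants α > 0, c₊ > 0 and c₋ > 0 such that d(t) = c₊·t^α for all t ≥ 0 and d(t) = −c₋·(−t)^α for all t ≤ 0; in particular ρˢ(h) = ρᶜ(h)^α for all h ∈ H. -/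
/-- If `u` and `v` are homomorphisms into the positive reals and `v` exceeds `1` wherever `u` does,
then `log ∘ v` is proportional to `log ∘ u`. -/
theorem MonoidHom.mul_log_eq_mul_log_of_one_lt {G : Type*} [Group G] (u v : G →* ℝ)
    (hu : ∀ g, 0 < u g) (hv : ∀ g, 0 < v g) (huv : ∀ g, 1 < u g → 1 < v g)
    {k : G} (hk : 1 < u k) (g : G) :
    Real.log (v g) * Real.log (u k) = Real.log (v k) * Real.log (u g) := by
  have huk : 0 < Real.log (u k) := Real.log_pos hk
  have hvk : 0 < Real.log (v k) := Real.log_pos (huv k hk)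
  have log_word (w : G →* ℝ) (hw : ∀ g, 0 < w g) (x : G) (n m : ℤ) :
      Real.log (w (x ^ n * k ^ m)) = n * Real.log (w x) + m * Real.log (w k) := by
    have log_zpow (y : G) (j : ℤ) : Real.log (w (y ^ j)) = j * Real.log (w y) := by
      simp
    rw [map_mul, Real.log_mul (hw _).ne' (hw _).ne', log_zpow, log_zpow]
  have ratio_le (x : G) :
      Real.log (u x) / Real.log (u k) ≤ Real.log (v x) / Real.log (v k) := by
    by_contra! hlt
    obtain ⟨q, hq1, hq2⟩ := exists_rat_btwn hlt
    have hden : (0 : ℝ) < q.den := by exact_mod_cast q.den_pos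
    rw [Rat.cast_def] at hq1 hq2
    rw [div_lt_div_iff₀ hvk hden] at hq1
    rw [div_lt_div_iff₀ hden huk] at hq2
    have hpos : 0 < Real.log (u (x ^ (q.den : ℤ) * k ^ (-q.num))) := by
      rw [log_word u hu]; push_cast; linarith
    have hpos' := Real.log_pos (huv _ ((Real.log_pos_iff (hu _).le).1 hpos))
    rw [log_word v hv] at hpos'
    push_cast at hpos'
    linarith
  have h1 := ratio_le g
  have h2 := ratio_le g⁻¹
  simp only [map_inv, Real.log_inv, neg_div, neg_le_neg_iff] at h2
  have h3 := h1.antisymm h2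
  rw [div_eq_div_iff huk.ne' hvk.ne'] at h3
  linarith

/-- A strictly increasing function on `(0, ∞)` that agrees with `x ↦ c * x ^ α` on a dense set
agrees with it everywhere. -/
theorem StrictMonoOn.eq_mul_rpow_of_dense {g : ℝ → ℝ} (hg : StrictMonoOn g (Set.Ioi 0))
    {S : Set ℝ} (hS : ∀ a b : ℝ, 0 < a → a < b → ∃ x ∈ S, a < x ∧ x < b)
    {c α : ℝ} (hc : 0 < c) (hα : 0 < α) (hgpos : ∀ t, 0 < t → 0 < g t)
    (heq : ∀ x ∈ S, 0 < x → g x = c * x ^ α) {t : ℝ} (ht : 0 < t) : g t = c * t ^ α := by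
  set y := (g t / c) ^ α⁻¹ with hy
  have hquot : 0 < g t / c := div_pos (hgpos t ht) hc
  have hypos : 0 < y := Real.rpow_pos_of_pos hquot _
  have hgy : g t = c * y ^ α := by
    rw [hy, Real.rpow_inv_rpow hquot.le hα.ne', mul_div_cancel₀ _ hc.ne']
  rcases lt_trichotomy t y with h | h | h
  · obtain ⟨x, hxS, htx, hxy⟩ := hS t y ht h
    have hx : 0 < x := ht.trans htx
    have h1 := hg ht hx htx
    rw [heq x hxS hx, hgy] at h1
    exact absurd h1 (mul_lt_mul_of_pos_left (Real.rpow_lt_rpow hx.le hxy hα) hc).not_gt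
  · rw [hgy, ← h]
  · obtain ⟨x, hxS, hyx, hxt⟩ := hS y t hypos h
    have hx : 0 < x := hypos.trans hyx
    have h1 := hg hx ht hxt
    rw [heq x hxS hx, hgy] at h1
    exact absurd h1 (mul_lt_mul_of_pos_left (Real.rpow_lt_rpow hypos.le hyx hα) hc).not_gt


/-- Let `H` be a group and `ρᶜ, ρˢ : H → (0, ∞)` group homomorphisms into the
multiplicative group of positive reals (modelled as monoid homomorphisms into `ℝ` with
positive values) such that the image of `ρᶜ` is dense in `(0, ∞)`.  Let `d : ℝ → ℝ` be
a strictly increasing function with `d 0 = 0` satisfying `d (ρᶜ h * t) = ρˢ h * d t`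
for all `h ∈ H`, `t ∈ ℝ`.  Then there are constants `α > 0`, `c₊ > 0`, `c₋ > 0` such
that `d t = c₊ * t ^ α` for `t ≥ 0` and `d t = -(c₋ * (-t) ^ α)` for `t ≤ 0`;
in particular `ρˢ h = (ρᶜ h) ^ α` for all `h`. -/
theorem developing_map_is_power_form
    {H : Type*} [Group H]
    (ρc ρs : H →* ℝ)
    (hρc_pos : ∀ h : H, 0 < ρc h)
    (hρs_pos : ∀ h : H, 0 < ρs h)
    (hdense : ∀ x : ℝ, 0 < x → x ∈ closure (Set.range ρc))
    (d : ℝ → ℝ) (hd : StrictMono d) (hd0 : d 0 = 0)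
    (heq : ∀ (h : H) (t : ℝ), d (ρc h * t) = ρs h * d t) :
    ∃ α cp cm : ℝ, 0 < α ∧ 0 < cp ∧ 0 < cm ∧
      (∀ t : ℝ, 0 ≤ t → d t = cp * t ^ α) ∧
      (∀ t : ℝ, t ≤ 0 → d t = -(cm * (-t) ^ α)) ∧
      ∀ h : H, ρs h = ρc h ^ α := by
  have hbtw : ∀ a b : ℝ, 0 < a → a < b → ∃ x ∈ Set.range ρc, a < x ∧ x < b := by
    intro a b ha hab
    obtain ⟨m, ham, hmb⟩ := exists_between hab
    obtain ⟨x, hx, hxr⟩ := mem_closure_iff.1 (hdense m (ha.trans ham)) (Set.Ioo a b) isOpen_Ioo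
      ⟨ham, hmb⟩
    exact ⟨x, hxr, hx⟩
  have hdpos : ∀ t, 0 < t → 0 < d t := fun t ht => hd0 ▸ hd ht
  have hdneg : ∀ t, 0 < t → 0 < -d (-t) := fun t ht => by
    have := hd (neg_lt_zero.2 ht)
    linarith
  have h1 := hdpos 1 one_pos
  have hone : ∀ h, 1 < ρc h → 1 < ρs h := by
    intro h hh
    have h2 := hd hh
    rw [← mul_one (ρc h), heq] at h2
    exact (lt_mul_iff_one_lt_left h1).1 h2
  obtain ⟨_, ⟨k, rfl⟩, hk, -⟩ := hbtw 1 2 one_pos one_lt_two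
  have hlogk := Real.log_pos hk
  set α := Real.log (ρs k) / Real.log (ρc k) with hα_def
  have hα : 0 < α := div_pos (Real.log_pos (hone k hk)) hlogk
  have hρ : ∀ h, ρs h = ρc h ^ α := by
    intro h
    have hprop := MonoidHom.mul_log_eq_mul_log_of_one_lt ρc ρs hρc_pos hρs_pos hone hk h
    rw [Real.rpow_def_of_pos (hρc_pos h), ← Real.exp_log (hρs_pos h)]
    congr 1
    rw [hα_def, mul_div_assoc', eq_div_iff hlogk.ne', hprop, mul_comm]
  refine ⟨α, d 1, -d (-1), hα, h1, hdneg 1 one_pos, ?_, ?_, hρ⟩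
  · intro t ht
    rcases ht.eq_or_lt with rfl | ht
    · rw [hd0, Real.zero_rpow hα.ne', mul_zero]
    refine (hd.strictMonoOn _).eq_mul_rpow_of_dense hbtw h1 hα hdpos ?_ ht
    rintro _ ⟨h, rfl⟩ -
    rw [← hρ, mul_comm (d 1), ← heq, mul_one]
  · intro t ht
    rcases ht.eq_or_lt with rfl | ht
    · rw [hd0, neg_zero, Real.zero_rpow hα.ne', mul_zero, neg_zero]
    have hmono : StrictMono fun s => -d (-s) := fun _ _ hs => neg_lt_neg (hd (neg_lt_neg hs))
    have hneg := (hmono.strictMonoOn _).eq_mul_rpow_of_dense hbtw (hdneg 1 one_pos) hα hdneg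
      (by
        rintro _ ⟨h, rfl⟩ -
        rw [← hρ, mul_comm (-d (-1)), mul_neg, ← heq, mul_neg_one])
      (neg_pos.2 ht)
    rw [← hneg, neg_neg, neg_neg]
end
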